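/- arXiv:2603.11038 — 2 statements merged into one kernel-verified Lean document; each statement's English description precedes it below -/
import Mathlib

section
/- If F is an infinite field and M is an M_d-matrix over F, then PR(M) ≤ 2^d · CR(M). -/
open MvPolynomial

section Defs

variable {F : Type*} [Field F]

/-- A polynomial in the block variables `x_{i,j}` (`i ∈ Fin d`, `j ∈ Fin n`) is
multilinear exactly in the blocks of `S`: every monomial has degree 1 in each block
`i ∈ S` and degree 0 in each block `i ∉ S`. -/
def IsMultilinearOn {d n : ℕ} (S : Finset (Fin d))
    (f : MvPolynomial (Fin d × Fin n) F) : Prop :=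
  ∀ m ∈ f.support, ∀ i : Fin d,
    (∑ j : Fin n, m (i, j)) = if i ∈ S then 1 else 0

/-- A multilinear form: degree 1 in every block of variables. -/
def IsMultilinear {d n : ℕ} (f : MvPolynomial (Fin d × Fin n) F) : Prop :=
  IsMultilinearOn Finset.univ f

/-- Commutative rank: the rank of the matrix over the field of fractions of the
polynomial ring. -/
noncomputable def CR {σ : Type*} {α β : Type*} [Fintype β]
    (M : Matrix α β (MvPolynomial σ F)) : ℕ :=
  (M.map (algebraMap (MvPolynomial σ F) (FractionRing (MvPolynomial σ F)))).rank

/-- `M` is the sum of `r` outer products `u ⊗ v`, where `u` has entries multilinear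
in the blocks of some `S ⊆ [d]` and `v` has entries multilinear in the complementary
blocks. -/
def HasPRDecomp {d n a b : ℕ}
    (M : Matrix (Fin a) (Fin b) (MvPolynomial (Fin d × Fin n) F)) (r : ℕ) : Prop :=
  ∃ (S : Fin r → Finset (Fin d))
    (u : Fin r → Fin a → MvPolynomial (Fin d × Fin n) F)
    (v : Fin r → Fin b → MvPolynomial (Fin d × Fin n) F),
    (∀ t i, IsMultilinearOn (S t) (u t i)) ∧
    (∀ t j, IsMultilinearOn (S t)ᶜ (v t j)) ∧
    M = ∑ t, Matrix.of fun i j => u t i * v t j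

/-- Partition rank of a matrix of multilinear forms. -/
noncomputable def PR {d n a b : ℕ}
    (M : Matrix (Fin a) (Fin b) (MvPolynomial (Fin d × Fin n) F)) : ℕ :=
  sInf {r | HasPRDecomp M r}

/-- Evaluation of a matrix of multilinear forms at a point `p ∈ (F^n)^d`. -/
noncomputable def evalMat {d n : ℕ} {α β : Type*}
    (M : Matrix α β (MvPolynomial (Fin d × Fin n) F)) (p : Fin d → Fin n → F) :
    Matrix α β F :=
  M.map (eval fun v => p v.1 v.2)

/-- Max-rank: the largest rank of a scalar evaluation. -/
noncomputable def MaxR {d n : ℕ} {α β : Type*} [Fintype β]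
    (M : Matrix α β (MvPolynomial (Fin d × Fin n) F)) : ℕ :=
  ⨆ p : Fin d → Fin n → F, (evalMat M p).rank

/-- Partial evaluation: substitute `x_i := p_i` for `i ∈ S`, leaving the other
blocks of variables untouched. -/
noncomputable def pevalMat {d n : ℕ} {α β : Type*}
    (M : Matrix α β (MvPolynomial (Fin d × Fin n) F)) (S : Finset (Fin d))
    (p : Fin d → Fin n → F) :
    Matrix α β (MvPolynomial (Fin d × Fin n) F) :=
  M.map (aeval fun v : Fin d × Fin n => if v.1 ∈ S then C (p v.1 v.2) else X v)

end Defs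

section D1

variable {F : Type*} [Field F]

/-- Partition-rank decomposition for matrices of linear forms: a sum of `r` outer
products, each either (scalars) ⊗ (linear forms) or (linear forms) ⊗ (scalars). -/
def HasPR1Decomp {n a b : ℕ}
    (M : Matrix (Fin a) (Fin b) (MvPolynomial (Fin n) F)) (r : ℕ) : Prop :=
  ∃ (c : Fin r → Bool)
    (u : Fin r → Fin a → MvPolynomial (Fin n) F)
    (v : Fin r → Fin b → MvPolynomial (Fin n) F),
    (∀ t i, (u t i).IsHomogeneous (if c t then 0 else 1)) ∧
    (∀ t j, (v t j).IsHomogeneous (if c t then 1 else 0)) ∧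
    M = ∑ t, Matrix.of fun i j => u t i * v t j

/-- Partition rank of a matrix of linear forms. -/
noncomputable def PR1 {n a b : ℕ}
    (M : Matrix (Fin a) (Fin b) (MvPolynomial (Fin n) F)) : ℕ :=
  sInf {r | HasPR1Decomp M r}

/-- Max-rank of a matrix of linear forms. -/
noncomputable def MaxR1 {n a b : ℕ}
    (M : Matrix (Fin a) (Fin b) (MvPolynomial (Fin n) F)) : ℕ :=
  ⨆ p : Fin n → F, (M.map (eval p)).rank

end D1

section Tensor3

variable {F : Type*} [Field F]

/-- Substitute the first two blocks of variables of a trilinear form at `x` and `y`,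
leaving a polynomial in the third block. -/
noncomputable def sub01 {n : ℕ} (T : MvPolynomial (Fin 3 × Fin n) F)
    (x y : Fin n → F) : MvPolynomial (Fin 3 × Fin n) F :=
  aeval (fun v : Fin 3 × Fin n =>
    if v.1 = 0 then C (x v.2) else if v.1 = 1 then C (y v.2) else X v) T

open Classical in
/-- The bias of a 3-tensor: the probability over `(x, y)` that `T(x, y, -)` is the
zero linear form. -/
noncomputable def bias {n : ℕ} [Fintype F] (T : MvPolynomial (Fin 3 × Fin n) F) : ℝ :=
  ((Finset.univ.filter fun p : (Fin n → F) × (Fin n → F) =>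
      sub01 T p.1 p.2 = 0).card : ℝ) /
    ((Fintype.card ((Fin n → F) × (Fin n → F))) : ℝ)

/-- The analytic rank of a 3-tensor. -/
noncomputable def AR {n : ℕ} [Fintype F] (T : MvPolynomial (Fin 3 × Fin n) F) : ℝ :=
  - Real.logb (Fintype.card F) (bias T)

/-- A slice-rank decomposition: `T = ∑ f_t g_t` with `f_t` a linear form in one
block and `g_t` a bilinear form in the other two blocks. -/
def HasSRDecomp {n : ℕ} (T : MvPolynomial (Fin 3 × Fin n) F) (r : ℕ) : Prop :=
  ∃ (c : Fin r → Fin 3) (f g : Fin r → MvPolynomial (Fin 3 × Fin n) F),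
    (∀ t, IsMultilinearOn {c t} (f t)) ∧
    (∀ t, IsMultilinearOn ({c t} : Finset (Fin 3))ᶜ (g t)) ∧
    T = ∑ t, f t * g t

/-- Slice rank of a 3-tensor. -/
noncomputable def SR {n : ℕ} (T : MvPolynomial (Fin 3 × Fin n) F) : ℕ :=
  sInf {r | HasSRDecomp T r}

/-- The matrix `mat T` of a 3-tensor, evaluated at `x` in its first block:
the `(j,k)` entry is `T(x, e_j, e_k)`. -/
noncomputable def matT {n : ℕ} (T : MvPolynomial (Fin 3 × Fin n) F)
    (x : Fin n → F) : Matrix (Fin n) (Fin n) F :=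
  Matrix.of fun j k => eval (fun v : Fin 3 × Fin n =>
    if v.1 = 0 then x v.2
    else if v.1 = 1 then (if v.2 = j then 1 else 0)
    else (if v.2 = k then 1 else 0)) T

end Tensor3

section Mult

variable {F : Type*} [Field F]

/-- `mult(f, p)`: the minimum total degree of a monomial of `f(x + p)`. -/
noncomputable def polyMult {n : ℕ} (f : MvPolynomial (Fin n) F) (p : Fin n → F) : ℕ :=
  sInf {k | ∃ m ∈ (aeval (fun i : Fin n => X i + C (p i)) f :
    MvPolynomial (Fin n) F).support, (∑ i, m i) = k}

end Mult

section Helpers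

lemma skel {K : Type*} [Field K] {a b : ℕ} (M : Matrix (Fin a) (Fin b) K) :
    ∃ (I : Fin M.rank → Fin a) (J : Fin M.rank → Fin b),
      (M.submatrix I J).det ≠ 0 ∧
      ∃ X : Matrix (Fin a) (Fin M.rank) K, M = X * M.submatrix I id := by
  have hex := Submodule.exists_fun_fin_finrank_span_eq K (Set.range M.row)
  rw [← Matrix.rank_eq_finrank_span_row] at hex
  obtain ⟨f, hf, hsp, hli⟩ := hex
  choose I hI using hf
  set N := M.submatrix I id with hN
  have hNf : N.row = f := by
    funext i; rw [← hI i]; rfl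
  have hr : N.rank = M.rank := by
    have := LinearIndependent.rank_matrix (M := N) (by rw [hNf]; exact hli)
    simpa using this
  have hex2 := Submodule.exists_fun_fin_finrank_span_eq K (Set.range N.col)
  rw [← Matrix.rank_eq_finrank_span_cols, hr] at hex2
  obtain ⟨g, hg, -, hgli⟩ := hex2
  choose J hJ using hg
  refine ⟨I, J, ?_, ?_⟩
  · have : LinearIndependent K (M.submatrix I J).col := by
      have hc : (M.submatrix I J).col = g := by
        funext i; rw [← hJ i]; rfl
      rw [hc]; exact hgli
    rw [Matrix.linearIndependent_cols_iff_isUnit, Matrix.isUnit_iff_isUnit_det] at this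
    exact this.ne_zero
  · have h : ∀ i, ∃ c : Fin M.rank → K, ∑ k, c k • f k = M.row i := by
      intro i
      rw [← Submodule.mem_span_range_iff_exists_fun, hsp]
      exact Submodule.subset_span ⟨i, rfl⟩
    choose X hX using h
    refine ⟨Matrix.of X, ?_⟩
    ext i j
    have := congrFun (hX i) j
    rw [← hNf] at this
    simp only [Finset.sum_apply, Pi.smul_apply, smul_eq_mul, Matrix.row] at this
    rw [Matrix.mul_apply, ← this]
    rfl

lemma skel_poly {σ F : Type*} [Field F] {a b : ℕ}
    (M : Matrix (Fin a) (Fin b) (MvPolynomial σ F)) :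
    ∃ (I : Fin (CR M) → Fin a) (J : Fin (CR M) → Fin b),
      (M.submatrix I J).det ≠ 0 ∧
      (M.submatrix I J).det • M =
        M.submatrix id J * ((M.submatrix I J).adjugate * M.submatrix I id) := by
  let φ := algebraMap (MvPolynomial σ F) (FractionRing (MvPolynomial σ F))
  obtain ⟨I, J, hdet, X, hX⟩ := skel (M.map φ)
  change Fin (CR M) → Fin a at I
  change Fin (CR M) → Fin b at J
  change Matrix (Fin a) (Fin (CR M)) _ at X
  have hφi : Function.Injective φ := IsFractionRing.injective _ _
  refine ⟨I, J, ?_, ?_⟩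
  · intro h
    apply hdet
    have := congrArg φ h
    rw [RingHom.map_det, map_zero] at this
    exact this
  · apply Matrix.map_injective hφi
    have e1 : ((M.submatrix I J).det • M).map φ = (M.map φ |>.submatrix I J).det • M.map φ := by
      ext i j
      have : φ (M.submatrix I J).det = (M.map φ |>.submatrix I J).det := RingHom.map_det _ _
      simp [this]
    have e2 : (M.submatrix I J).adjugate.map φ = (M.map φ |>.submatrix I J).adjugate :=
      RingHom.map_adjugate φ _
    have e3 : (M.map φ).submatrix id J = X * (M.map φ).submatrix I J := by
      ext i j
      have := congrFun (congrFun hX i) (J j)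
      exact this
    change ((M.submatrix I J).det • M).map φ = _
    simp only [Matrix.map_mul]
    rw [e1, e2]
    change _ = (M.map φ).submatrix id J * (_ * (M.map φ).submatrix I id)
    rw [e3, Matrix.mul_assoc, ← Matrix.mul_assoc _ (Matrix.adjugate _), Matrix.mul_adjugate,
      Matrix.smul_mul, Matrix.mul_smul, Matrix.one_mul]
    exact congrArg (fun Y => ((M.map φ).submatrix I J).det • Y) hX

variable {F : Type*} [Field F] {d n : ℕ}

/-- weights of the variables -/
def bw (d n : ℕ) (v : Fin d × Fin n) : Fin d → ℕ := Pi.single v.1 1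

/-- indicator multidegree -/
def ind (S : Finset (Fin d)) : Fin d → ℕ := fun i => if i ∈ S then 1 else 0

lemma weight_bw (m : Fin d × Fin n →₀ ℕ) (i : Fin d) :
    Finsupp.weight (bw d n) m i = ∑ j, m (i, j) := by
  rw [Finsupp.weight_apply, Finsupp.sum_fintype _ _ (by simp), Finset.sum_apply,
    Fintype.sum_prod_type, Finset.sum_eq_single i]
  · simp [bw]
  · intro k _ hk
    simp [bw, Ne.symm hk]
  · simp

/-- multilinear component -/
noncomputable def P (S : Finset (Fin d)) :
    MvPolynomial (Fin d × Fin n) F →ₗ[F] MvPolynomial (Fin d × Fin n) F :=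
  weightedHomogeneousComponent (bw d n) (ind S)

lemma coeff_P (S : Finset (Fin d)) (f : MvPolynomial (Fin d × Fin n) F) (m) :
    coeff m (P S f) = if Finsupp.weight (bw d n) m = ind S then coeff m f else 0 := by
  rw [P, coeff_weightedHomogeneousComponent]

lemma P_multilinear (S : Finset (Fin d)) (f : MvPolynomial (Fin d × Fin n) F) :
    IsMultilinearOn S (P S f) := by
  intro m hm i
  rw [mem_support_iff, coeff_P] at hm
  have h : Finsupp.weight (bw d n) m = ind S := by
    by_contra h; simp [h] at hm
  rw [← weight_bw, h]; rfl

lemma P_monomial (S : Finset (Fin d)) (m : Fin d × Fin n →₀ ℕ) (c : F) :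
    P S (monomial m c) = if Finsupp.weight (bw d n) m = ind S then monomial m c else 0 := by
  classical
  ext k
  rw [coeff_P, coeff_monomial]
  by_cases hk : m = k
  · subst hk; split_ifs <;> simp_all
  · split_ifs <;> simp [coeff_monomial, hk]

lemma P_mul (f g : MvPolynomial (Fin d × Fin n) F) :
    P Finset.univ (f * g) = ∑ S, P S f * P Sᶜ g := by
  classical
  induction f using MvPolynomial.induction_on' with
  | add p q hp hq => simp only [add_mul, map_add, hp, hq, Finset.sum_add_distrib]
  | monomial m c =>
  induction g using MvPolynomial.induction_on' with
  | add p q hp hq => simp only [mul_add, map_add, hp, hq, Finset.sum_add_distrib]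
  | monomial k e =>
  rw [monomial_mul]
  simp only [P_monomial, map_add]
  by_cases h : Finsupp.weight (bw d n) m + Finsupp.weight (bw d n) k = ind Finset.univ
  · rw [if_pos h]
    have h' : ∀ i, Finsupp.weight (bw d n) m i + Finsupp.weight (bw d n) k i = 1 := by
      intro i; have := congrFun h i; simpa [ind] using this
    rw [Finset.sum_eq_single (Finset.univ.filter fun i => Finsupp.weight (bw d n) m i = 1)]
    · rw [if_pos, if_pos, monomial_mul]
      · funext i
        have := h' i
        simp only [ind, Finset.mem_compl, Finset.mem_filter, Finset.mem_univ, true_and]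
        split_ifs <;> omega
      · funext i
        have := h' i
        simp only [ind, Finset.mem_filter, Finset.mem_univ, true_and]
        split_ifs <;> omega
    · intro S _ hS
      rw [if_neg, zero_mul]
      intro hm
      apply hS
      ext i
      simp [hm, ind]
    · simp
  · rw [if_neg h, Finset.sum_eq_zero]
    intro S _
    by_cases h1 : Finsupp.weight (bw d n) m = ind S
    · rw [if_neg (c := Finsupp.weight (bw d n) k = ind Sᶜ), mul_zero]
      intro h2
      apply h
      rw [h1, h2]
      funext i
      by_cases hi : i ∈ S <;> simp [ind, hi]
    · rw [if_neg h1, zero_mul]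

lemma degree_of_weight {m : Fin d × Fin n →₀ ℕ}
    (h : Finsupp.weight (bw d n) m = ind Finset.univ) : m.degree = d := by
  rw [Finsupp.degree_eq_sum, Fintype.sum_prod_type]
  simp only [← weight_bw, h]
  simp [ind]

/-- translation -/
noncomputable def T {σ : Type*} (p : σ → F) : MvPolynomial σ F →ₐ[F] MvPolynomial σ F :=
  aeval fun v => X v + C (p v)

lemma coeff_T_monomial {σ : Type*} (p : σ → F) (m : σ →₀ ℕ) : ∀ m' : σ →₀ ℕ,
    m.degree ≤ m'.degree → 
    coeff m' (T p (monomial m 1)) = coeff m' (monomial m (1 : F)) := by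
  classical
  induction hk : m.degree generalizing m with
  | zero =>
    intro m' _
    have : m = 0 := (Finsupp.degree_eq_zero_iff m).mp hk
    subst this
    have : (monomial 0 (1 : F) : MvPolynomial σ F) = 1 := rfl
    rw [this, map_one]
  | succ k ih =>
    intro m' hm'
    have hne : m ≠ 0 := by rintro rfl; simp at hk
    obtain ⟨v, hv⟩ := Finsupp.ne_iff.mp hne
    obtain ⟨m₀, rfl⟩ : ∃ m₀, m = m₀ + Finsupp.single v 1 :=
      ⟨m - Finsupp.single v 1, by
        rw [tsub_add_cancel_of_le]
        rw [Finsupp.single_le_iff]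
        simp at hv; omega⟩
    have hk0 : m₀.degree = k := by simpa [map_add] using hk
    have e : (monomial (m₀ + Finsupp.single v 1) (1 : F)) = monomial m₀ 1 * X v := by
      rw [X, monomial_mul, one_mul]
    rw [e, map_mul]
    have : T p (X v) = X v + C (p v) := by simp [T]
    rw [this, mul_add, coeff_add, mul_comm _ (C (p v)), coeff_C_mul, ih m₀ hk0 m' (by omega), coeff_monomial, if_neg,
      mul_zero, add_zero, coeff_mul_X', coeff_mul_X']
    · split_ifs with h
      · apply ih m₀ hk0
        have h1 : m' = (m' - Finsupp.single v 1) + Finsupp.single v 1 := by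
          rw [tsub_add_cancel_of_le]
          rw [Finsupp.single_le_iff]
          simp at h; omega
        rw [h1, map_add] at hm'
        simp at hm'; omega
      · rfl
    · rintro rfl; omega

lemma P_T (p : Fin d × Fin n → F) (f : MvPolynomial (Fin d × Fin n) F) (hf : IsMultilinear f) :
    P Finset.univ (T p f) = f := by
  have hw : ∀ m ∈ f.support, Finsupp.weight (bw d n) m = ind Finset.univ := by
    intro m hm
    funext i
    rw [weight_bw, hf m hm i]; rfl
  ext m
  rw [coeff_P]
  split_ifs with h
  · conv_lhs => rw [f.as_sum]
    conv_rhs => rw [f.as_sum]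
    rw [map_sum, coeff_sum, coeff_sum]
    apply Finset.sum_congr rfl
    intro k hk
    have : monomial k (coeff k f) = (coeff k f) • monomial k (1 : F) := by
      rw [smul_monomial]; simp
    rw [this, map_smul, coeff_smul, coeff_smul, coeff_T_monomial]
    rw [degree_of_weight h, degree_of_weight (hw k hk)]
  · by_contra h'
    exact h (hw m (mem_support_iff.mpr (Ne.symm h')))

lemma constantCoeff_T {σ : Type*} (p : σ → F) (f : MvPolynomial σ F) :
    constantCoeff (T p f) = eval p f := by
  have : (constantCoeff.comp (T p).toRingHom) = (eval p : MvPolynomial σ F →+* F) := by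
    apply MvPolynomial.ringHom_ext <;> simp [T]
  exact congrArg (fun φ => φ f) this

lemma coeff_pow_mul {σ : Type*} (e : MvPolynomial σ F) (he : constantCoeff e = 0) (k : ℕ) :
    ∀ (g : MvPolynomial σ F) (m : σ →₀ ℕ), m.degree < k → coeff m (e ^ k * g) = 0 := by
  classical
  induction k with
  | zero => intro g m hm; omega
  | succ k ih =>
    intro g m hm
    rw [pow_succ', mul_assoc, coeff_mul]
    apply Finset.sum_eq_zero
    rintro ⟨x, y⟩ hxy
    rw [Finset.HasAntidiagonal.mem_antidiagonal] at hxy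
    simp only at hxy ⊢
    by_cases hx : x = 0
    · subst hx
      have : coeff 0 e = 0 := he
      rw [this, zero_mul]
    · rw [ih, mul_zero]
      have h1 : x.degree ≠ 0 := fun h => hx ((Finsupp.degree_eq_zero_iff x).mp h)
      have h2 : x.degree + y.degree = m.degree := by rw [← hxy, map_add]
      omega

/-- approximate inverse -/
lemma approx_inv {σ : Type*} (δ : MvPolynomial σ F) (h : constantCoeff δ ≠ 0) (k : ℕ) :
    ∃ q e : MvPolynomial σ F, constantCoeff e = 0 ∧ q * δ = 1 - e ^ k := by
  set c := constantCoeff δ with hc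
  refine ⟨(∑ i ∈ Finset.range k, (1 - C c⁻¹ * δ) ^ i) * C c⁻¹, 1 - C c⁻¹ * δ, ?_, ?_⟩
  · simp [← hc, h]
  · rw [← geom_sum_mul_neg]; ring

end Helpers

/-- Over an infinite field, `PR(M) ≤ 2^d · CR(M)`. -/
theorem statement_1 (F : Type*) [Field F] [Infinite F] (d n a b : ℕ) (hn : 1 ≤ n)
    (M : Matrix (Fin a) (Fin b) (MvPolynomial (Fin d × Fin n) F))
    (hM : ∀ i j, IsMultilinear (M i j)) :
    PR M ≤ 2 ^ d * CR M := by
  apply Nat.sInf_le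
  obtain ⟨I, J, hdet, hfac⟩ := skel_poly M
  obtain ⟨p, hp⟩ : ∃ p, eval p (M.submatrix I J).det ≠ 0 := by
    by_contra! h
    exact hdet (MvPolynomial.funext (by simpa using h))
  set δ := (M.submatrix I J).det
  obtain ⟨q, e, he, hq⟩ := approx_inv (T p δ) (by rwa [constantCoeff_T]) (d + 1)
  set W := (M.submatrix I J).adjugate * M.submatrix I id
  have key : ∀ i j, M i j =
      ∑ S : Finset (Fin d), ∑ k, P S (T p (M i (J k))) * P Sᶜ (q * T p (W k j)) := by
    intro i j
    have h1 : δ * M i j = ∑ k, M i (J k) * W k j := by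
      have := congrFun (congrFun hfac i) j
      rw [Matrix.mul_apply] at this
      exact this
    have h2 : T p (M i j) - e ^ (d + 1) * T p (M i j) =
        ∑ k, T p (M i (J k)) * (q * T p (W k j)) := by
      have := congrArg (fun f => q * T p f) h1
      simp only [map_mul, map_sum] at this
      rw [← mul_assoc, hq, Finset.mul_sum] at this
      rw [← one_sub_mul, this]
      exact Finset.sum_congr rfl fun k _ => by ring
    have h3 := congrArg (P Finset.univ) h2
    rw [map_sub, P_T p _ (hM i j), map_sum] at h3
    have h4 : P Finset.univ (e ^ (d + 1) * T p (M i j)) = 0 := by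
      ext m
      rw [coeff_P, coeff_zero]
      split_ifs with h
      · exact coeff_pow_mul e he _ _ _ (by rw [degree_of_weight h]; omega)
      · rfl
    rw [h4, sub_zero] at h3
    rw [h3, Finset.sum_comm]
    exact Finset.sum_congr rfl fun k _ => P_mul _ _
  let E : Fin (2 ^ d * CR M) ≃ Finset (Fin d) × Fin (CR M) :=
    (Fintype.equivFinOfCardEq (by simp)).symm
  refine ⟨fun t => (E t).1, fun t i => P (E t).1 (T p (M i (J (E t).2))),
    fun t j => P (E t).1ᶜ (q * T p (W (E t).2 j)),
    fun t i => P_multilinear _ _, fun t j => P_multilinear _ _, ?_⟩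
  ext1 i j
  rw [Matrix.sum_apply, key i j, ← Fintype.sum_prod_type',
    ← E.sum_comp fun x : Finset (Fin d) × Fin (CR M) =>
      P x.1 (T p (M i (J x.2))) * P x.1ᶜ (q * T p (W x.2 j))]
  rfl
end

section
/- Let F = F_q be a finite field with q elements and d ≥ 0, and suppose (2^d − 1)(q − 1)^d − (2^d − 2)q^d > 0. Then for every M_d-matrix M over F_q, PR(M) ≤ [2^d (q−1)^d / ((2^d − 1)(q − 1)^d − (2^d − 2)q^d)] · CR(M). -/
open MvPolynomial

section Helpers

open scoped Matrix

theorem field_minor {K : Type*} [Field K] {a b : ℕ} (M : Matrix (Fin a) (Fin b) K) :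
    ∃ (ι : Fin M.rank → Fin a) (κ : Fin M.rank → Fin b), (M.submatrix ι κ).det ≠ 0 := by
  have key : ∀ {a b : ℕ} (M : Matrix (Fin a) (Fin b) K) (r : ℕ), M.rank = r → 
      ∃ κ : Fin r → Fin b, LinearIndependent K (M.submatrix id κ).col := by
    intro a b M r hr
    obtain ⟨κ, f, hf, hs, hl⟩ := exists_linearIndependent' K M.col
    have : Finite κ := Finite.of_injective f hf
    have := Fintype.ofFinite κ
    have hc : Fintype.card κ = r := by
      rw [← hr, Matrix.rank_eq_finrank_span_cols, ← hs, finrank_span_eq_card hl]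
    let e : Fin r ≃ κ := (Fintype.equivFinOfCardEq hc).symm
    exact ⟨f ∘ e, hl.comp e e.injective⟩
  obtain ⟨κ, hκ⟩ := key M _ rfl
  have h1 : (M.submatrix id κ).transpose.rank = M.rank := by
    rw [Matrix.rank_transpose, Matrix.rank_eq_finrank_span_cols, finrank_span_eq_card hκ]
    simp
  obtain ⟨ι, hι⟩ := key _ _ h1
  refine ⟨ι, κ, ?_⟩
  have : LinearIndependent K (M.submatrix ι κ).row := hι
  rw [Matrix.linearIndependent_rows_iff_isUnit, Matrix.isUnit_iff_isUnit_det] at this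
  exact this.ne_zero

theorem rank_le_rank_frac {B : Type*} [CommRing B] [IsDomain B] {a b : ℕ}
    (M : Matrix (Fin a) (Fin b) B) :
    M.rank ≤ (M.map (algebraMap B (FractionRing B))).rank := by
  set K := FractionRing B
  obtain ⟨v, hv⟩ := exists_linearIndependent_of_le_finrank (R := B)
    (M := LinearMap.range M.mulVecLin) (n := M.rank) le_rfl
  have hv1 : LinearIndependent B (fun i => (v i : Fin a → B)) :=
    hv.map' (Submodule.subtype _) (Submodule.ker_subtype _)
  let φ : (Fin a → B) →ₗ[B] (Fin a → K) := (Algebra.linearMap B K).compLeft (Fin a)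
  have hφ : LinearMap.ker φ = ⊥ := by
    rw [LinearMap.ker_eq_bot]
    intro x y h
    ext i
    exact IsFractionRing.injective B K (congrFun h i)
  have hv2 := hv1.map' φ hφ
  rw [LinearIndependent.iff_fractionRing B K] at hv2
  choose c hc using fun i => (v i).2
  have hv3 : LinearIndependent K (fun i =>
      (⟨φ (v i), by
        refine ⟨fun j => algebraMap B K (c i j), ?_⟩
        rw [← hc i]
        ext k
        simp [φ, Matrix.mulVec, dotProduct]⟩ :
        LinearMap.range (M.map (algebraMap B K)).mulVecLin)) :=
    LinearIndependent.of_comp (Submodule.subtype _) hv2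
  have := hv3.fintype_card_le_finrank
  rw [Fintype.card_fin] at this
  exact this

theorem le_rank_of_minor {B : Type*} [CommRing B] [IsDomain B] {a b r : ℕ}
    (M : Matrix (Fin a) (Fin b) B) (ι : Fin r → Fin a) (κ : Fin r → Fin b)
    (h : (M.submatrix ι κ).det ≠ 0) : r ≤ M.rank := by
  have h1 := Matrix.rank_of_det_ne_zero h
  have h2 := Matrix.rank_submatrix_le M ι κ
  simp at h1
  omega

theorem exists_minor {B : Type*} [CommRing B] [IsDomain B] {a b : ℕ}
    (M : Matrix (Fin a) (Fin b) B) :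
    ∃ (ι : Fin M.rank → Fin a) (κ : Fin M.rank → Fin b), (M.submatrix ι κ).det ≠ 0 := by
  obtain ⟨ι, κ, h⟩ := field_minor (M.map (algebraMap B (FractionRing B)))
  have hle := rank_le_rank_frac M
  have h' : (M.submatrix ι κ).det ≠ 0 := by
    intro h0
    apply h
    have : (M.map (algebraMap B (FractionRing B))).submatrix ι κ
      = (algebraMap B (FractionRing B)).mapMatrix (M.submatrix ι κ) := by ext; simp
    rw [this, ← RingHom.map_det, h0, map_zero]
  have hge := le_rank_of_minor M ι κ h'
  have heq := le_antisymm hle hge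
  clear hle hge h
  revert ι κ
  rw [← heq]
  intro ι κ h
  exact ⟨ι, κ, h⟩

theorem rank_map_le' {B B' : Type*} [CommRing B] [IsDomain B] [CommRing B'] [IsDomain B']
    {a b : ℕ} (M : Matrix (Fin a) (Fin b) B) (f : B →+* B') :
    (M.map f).rank ≤ M.rank := by
  obtain ⟨ι, κ, h⟩ := exists_minor (M.map f)
  refine le_rank_of_minor M ι κ fun h0 => h ?_
  have : (M.map f).submatrix ι κ = f.mapMatrix (M.submatrix ι κ) := by ext; simp
  rw [this, ← RingHom.map_det, h0, map_zero]

theorem finrank_range_add_ker {B : Type*} [CommRing B] [IsDomain B] {V W : Type*}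
    [AddCommGroup V] [Module B V] [AddCommGroup W] [Module B W] [Module.Finite B V]
    (f : V →ₗ[B] W) :
    Module.finrank B (LinearMap.range f) + Module.finrank B (LinearMap.ker f)
      = Module.finrank B V := by
  rw [← (LinearMap.quotKerEquivRange f).finrank_eq]
  exact Submodule.finrank_quotient_add_finrank _

theorem rank_le_of_ker {B : Type*} [CommRing B] [IsDomain B] [IsNoetherianRing B] {a a' b : ℕ}
    (f : (Fin b → B) →ₗ[B] (Fin a → B)) (g : (Fin b → B) →ₗ[B] (Fin a' → B)) :
    Module.finrank B (LinearMap.range f) ≤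
      Module.finrank B ((LinearMap.ker g).map f) + Module.finrank B (LinearMap.range g) := by
  have h1 := finrank_range_add_ker f
  have h2 := finrank_range_add_ker g
  have h3 := finrank_range_add_ker (f.domRestrict (LinearMap.ker g))
  rw [LinearMap.range_domRestrict] at h3
  have h4 : Module.finrank B (LinearMap.ker (f.domRestrict (LinearMap.ker g))) ≤
      Module.finrank B (LinearMap.ker f) := by
    rw [LinearMap.ker_domRestrict, ← Submodule.finrank_map_subtype_eq]
    apply Submodule.finrank_mono
    rintro _ ⟨x, hx, rfl⟩
    exact hx
  omega

theorem rank_coeff_one_le {B : Type*} [CommRing B] [IsDomain B] [IsNoetherianRing B] {a b : ℕ}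
    (G : Matrix (Fin a) (Fin b) (Polynomial B)) :
    (G.map (fun p => p.coeff 1)).rank ≤ G.rank + (G.map (fun p => p.coeff 0)).rank := by
  set G0 := G.map (fun p => p.coeff 0) with hG0
  set G1 := G.map (fun p => p.coeff 1) with hG1
  set Z := LinearMap.range G0.mulVecLin ⊔ (LinearMap.ker G0.mulVecLin).map G1.mulVecLin with hZ
  have hm : Module.finrank B Z ≤ G.rank := by
    obtain ⟨v, hv⟩ := exists_linearIndependent_of_le_finrank (R := B) (M := Z) le_rfl
    have hv1 : LinearIndependent B (fun i => (v i : Fin a → B)) :=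
      hv.map' (Submodule.subtype _) (Submodule.ker_subtype _)
    have hex : ∀ i, ∃ y x : Fin b → B, G0.mulVec x = 0 ∧
        (v i : Fin a → B) = G0.mulVec y + G1.mulVec x := by
      intro i
      obtain ⟨p, ⟨y, rfl⟩, q, ⟨x, hx, rfl⟩, h⟩ := Submodule.mem_sup.1 (v i).2
      exact ⟨y, x, hx, h.symm⟩
    choose y x hx hvi using hex
    let H : Matrix (Fin b) (Fin (Module.finrank B Z)) (Polynomial B) :=
      Matrix.of fun j i => Polynomial.X * Polynomial.C (y i j) + Polynomial.C (x i j)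
    let W : Matrix (Fin a) (Fin (Module.finrank B Z)) (Polynomial B) :=
      (G * H).map Polynomial.divX
    have hW : (Polynomial.X : Polynomial B) • W = G * H := by
      ext1 k i
      have h0 : ((G * H) k i).coeff 0 = 0 := by
        have := congrFun (hx i) k
        simpa [Matrix.mul_apply, H, Polynomial.finsetSum_coeff, Polynomial.mul_coeff_zero,
          Matrix.mulVec, dotProduct, hG0] using this
      have := Polynomial.X_mul_divX_add ((G * H) k i)
      rw [h0] at this
      simpa [W] using this
    have hWV : ∀ i k, (W k i).coeff 0 = (v i : Fin a → B) k := by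
      intro i k
      rw [hvi]
      have : ∀ (p : Polynomial B) (y x : B), (p * (Polynomial.X * Polynomial.C y +
          Polynomial.C x)).coeff 1 = p.coeff 0 * y + p.coeff 1 * x := by
        intro p y x
        rw [mul_add, mul_left_comm, Polynomial.coeff_add, Polynomial.coeff_X_mul]
        simp
      simp only [W, Matrix.map_apply, Polynomial.coeff_divX, Matrix.mul_apply, H, Matrix.of_apply,
        Polynomial.finsetSum_coeff, zero_add, this, Finset.sum_add_distrib]
      rfl
    have h1 : (G * H).rank = W.rank := by
      rw [← hW]
      exact Matrix.rank_smul_of_mem_nonZeroDivisors W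
        (mem_nonZeroDivisors_of_ne_zero Polynomial.X_ne_zero)
    have h2 := Matrix.rank_mul_le_left G H
    have h3 := rank_map_le' W (Polynomial.constantCoeff (R := B))
    have h4 : (W.map (Polynomial.constantCoeff (R := B))).rank = Module.finrank B Z := by
      rw [Matrix.rank_eq_finrank_span_cols]
      have : (W.map (Polynomial.constantCoeff (R := B))).col = fun i => (v i : Fin a → B) := by
        ext i k
        simp [← hWV, Matrix.col]
      rw [this, finrank_span_eq_card hv1, Fintype.card_fin]
    omega
  have h1 := rank_le_of_ker G1.mulVecLin G0.mulVecLin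
  have h2 : Module.finrank B ((LinearMap.ker G0.mulVecLin).map G1.mulVecLin) ≤
    Module.finrank B Z := Submodule.finrank_mono le_sup_right
  unfold Matrix.rank at *
  omega

/-- Schur complement. -/
theorem schur_rank {B : Type*} [CommRing B] [IsDomain B] [IsNoetherianRing B] {a b s : ℕ}
    (M : Matrix (Fin a) (Fin b) B) (ι : Fin s → Fin a) (κ : Fin s → Fin b)
    (h : (M.submatrix ι κ).det ≠ 0) :
    ((M.submatrix ι κ).det • M - M.submatrix id κ * ((M.submatrix ι κ).adjugate *
      M.submatrix ι id)).rank + s ≤ M.rank := by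
  set E := (M.submatrix ι κ).det • M - M.submatrix id κ * ((M.submatrix ι κ).adjugate *
      M.submatrix ι id) with hE
  set δ := (M.submatrix ι κ).det
  have hcol : M.submatrix id κ = M * (1 : Matrix (Fin b) (Fin b) B).submatrix id κ := by
    ext i j
    simp [Matrix.mul_apply, Matrix.one_apply]
  have hE1 : E = M * (δ • 1 - (1 : Matrix (Fin b) (Fin b) B).submatrix id κ *
      ((M.submatrix ι κ).adjugate * M.submatrix ι id)) := by
    rw [hE, hcol]
    simp [Matrix.mul_sub, Matrix.mul_assoc]
  have hE2 : E.submatrix ι id = 0 := by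
    have : E.submatrix ι id = δ • M.submatrix ι id - M.submatrix ι κ *
      ((M.submatrix ι κ).adjugate * M.submatrix ι id) := by
      ext i j
      simp [hE, Matrix.mul_apply]
    rw [this, ← Matrix.mul_assoc, Matrix.mul_adjugate]
    simp [δ]
  let V := LinearMap.range M.mulVecLin
  let π : V →ₗ[B] (Fin s → B) := (LinearMap.funLeft B B ι).comp V.subtype
  have h1 := finrank_range_add_ker π
  have h2 : s ≤ Module.finrank B (LinearMap.range π) := by
    have h3 := Matrix.rank_of_det_ne_zero h
    rw [Fintype.card_fin] at h3
    refine h3.symm.le.trans ?_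
    apply Submodule.finrank_mono
    rintro _ ⟨x, rfl⟩
    refine ⟨⟨_, (1 : Matrix (Fin b) (Fin b) B).submatrix id κ *ᵥ x, rfl⟩, ?_⟩
    ext i
    simp only [π, LinearMap.comp_apply, Submodule.subtype_apply, LinearMap.funLeft_apply,
      Matrix.mulVecLin_apply, Matrix.mulVec_mulVec, ← hcol]
    rfl
  have h4 : E.rank ≤ Module.finrank B (LinearMap.ker π) := by
    rw [← Submodule.finrank_map_subtype_eq]
    apply Submodule.finrank_mono
    rintro _ ⟨x, rfl⟩
    refine ⟨⟨E *ᵥ x, ?_⟩, ?_, rfl⟩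
    · rw [hE1, ← Matrix.mulVec_mulVec]
      exact ⟨_, rfl⟩
    · ext i
      have : (E.submatrix ι id *ᵥ x) i = 0 := by rw [hE2]; simp
      exact this
  have h5 : M.rank = Module.finrank B V := rfl
  omega

theorem corank_le_field {K : Type*} [Field K] {r m : ℕ}
    (G : Matrix (Fin r) (Fin r) (Polynomial K)) (h : G.det.coeff m ≠ 0) :
    r ≤ (G.map (fun p => p.coeff 0)).rank + m := by
  set G0 := G.map (fun p => p.coeff 0) with hG0
  by_contra hlt
  push Not at hlt
  obtain ⟨V, U, e, hV, hU, hN⟩ := Matrix.exists_rank_normal_form G0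
  rw [Matrix.isUnit_iff_isUnit_det] at hV hU
  let c : K →+* Polynomial K := Polynomial.C
  let H := c.mapMatrix V * G * c.mapMatrix U
  have hH0 : H.map (Polynomial.constantCoeff (R := K)) = V * G0 * U := by
    have : ∀ A : Matrix (Fin r) (Fin r) K,
        (Polynomial.constantCoeff (R := K)).mapMatrix (c.mapMatrix A) = A := by
      intro A; ext i j; simp [c]
    change (Polynomial.constantCoeff (R := K)).mapMatrix H = _
    simp only [H, map_mul, this]
    rfl
  let D : Fin r → Polynomial K := fun j => Sum.elim (fun _ => 1) (fun _ => Polynomial.X) (e j)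
  let H' : Matrix (Fin r) (Fin r) (Polynomial K) := Matrix.of fun i j =>
    Sum.elim (fun _ => H i j) (fun _ => (H i j).divX) (e j)
  have hHD : H = H' * Matrix.diagonal D := by
    ext1 i j
    rw [Matrix.mul_diagonal]
    rcases hj : e j with k | k
    · simp [H', D, hj]
    · have h0 : (H i j).coeff 0 = 0 := by
        have := congrFun (congrFun hH0 i) j
        rw [hN] at this
        simp [hj, Matrix.fromBlocks] at this
        rcases hi : e i with l | l <;> simpa [hi] using this
      have := Polynomial.divX_mul_X_add (H i j)
      rw [h0] at this
      simpa [H', D, hj] using this.symm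
  have hdetD : (Matrix.diagonal D).det = Polynomial.X ^ (r - G0.rank) := by
    rw [Matrix.det_diagonal, ← e.symm.prod_comp, Fintype.prod_sum_type]
    simp [D]
  have hdetH : H.det = Polynomial.C (V.det * U.det) * G.det := by
    simp only [H, Matrix.det_mul, ← RingHom.map_det, c, map_mul]
    ring
  have h3 : H.det.coeff m = 0 := by
    rw [hHD, Matrix.det_mul, hdetD, Polynomial.coeff_mul_X_pow', if_neg (by omega)]
  rw [hdetH, Polynomial.coeff_C_mul] at h3
  exact (mul_ne_zero (hV.mul hU).ne_zero h) h3

/-- corank is at most order of vanishing of determinant. -/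
theorem corank_le {B : Type*} [CommRing B] [IsDomain B] {r m : ℕ}
    (G : Matrix (Fin r) (Fin r) (Polynomial B)) (h : G.det.coeff m ≠ 0) :
    r ≤ (G.map (fun p => p.coeff 0)).rank + m := by
  let f := algebraMap B (FractionRing B)
  have h1 := corank_le_field (m := m) ((Polynomial.mapRingHom f).mapMatrix G) (by
    rw [← RingHom.map_det, Polynomial.coe_mapRingHom, Polynomial.coeff_map]
    intro h0
    exact h (IsFractionRing.injective B (FractionRing B) (by rw [h0, map_zero])))
  have h2 := rank_map_le' (G.map (fun p => p.coeff 0)) f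
  have h3 : (((Polynomial.mapRingHom f).mapMatrix G).map (fun p => p.coeff 0)) =
    (G.map (fun p => p.coeff 0)).map f := by
    ext i j
    simp
  rw [h3] at h1
  omega

section PolyPart

variable {F : Type*} [Field F] {σ : Type*} [Fintype σ] [DecidableEq σ]

open Classical in
/-- Keep only the monomials satisfying `P`. -/
noncomputable def fil (P : (σ →₀ ℕ) → Prop) (f : MvPolynomial σ F) : MvPolynomial σ F :=
  ∑ m ∈ f.support with P m, monomial m (coeff m f)

open Classical in
theorem coeff_fil (P : (σ →₀ ℕ) → Prop) (f : MvPolynomial σ F) (μ : σ →₀ ℕ) :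
    coeff μ (fil P f) = if P μ then coeff μ f else 0 := by
  unfold fil
  rw [coeff_sum]
  simp only [coeff_monomial]
  rw [Finset.sum_ite_eq']
  simp only [Finset.mem_filter, mem_support_iff]
  by_cases h : P μ <;> by_cases h' : coeff μ f = 0 <;> simp [h, h']

/-- scale the variables in `T` by `t` -/
noncomputable def psi (T : Finset σ) : MvPolynomial σ F →ₐ[F] Polynomial (MvPolynomial σ F) :=
  aeval (fun v => if v ∈ T then Polynomial.X * Polynomial.C (X v) else Polynomial.C (X v))

theorem psi_monomial (T : Finset σ) (ν : σ →₀ ℕ) (a : F) :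
    psi T (monomial ν a) = Polynomial.monomial (∑ v ∈ T, ν v) (monomial ν a) := by
  rw [psi, aeval_monomial, monomial_eq (a := a) (s := ν), Finsupp.prod_fintype _ _ (by simp),
    Finsupp.prod_fintype _ _ (by simp)]
  have h1 : ∀ v, (if v ∈ T then Polynomial.X * Polynomial.C (X v) else
      Polynomial.C (X v) : Polynomial (MvPolynomial σ F)) ^ ν v =
      Polynomial.X ^ (if v ∈ T then ν v else 0) * Polynomial.C (X v ^ ν v) := by
    intro v
    split_ifs <;> simp only [mul_pow, map_pow, pow_zero, one_mul]
  simp only [h1]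
  rw [Finset.prod_mul_distrib, Finset.prod_pow_eq_pow_sum, ← map_prod, Finset.sum_ite_mem,
    Finset.univ_inter, ← Polynomial.C_mul_X_pow_eq_monomial, map_mul]
  have : algebraMap F (Polynomial (MvPolynomial σ F)) a = Polynomial.C (C a) := rfl
  rw [this]
  ring

theorem coeff_psi (T : Finset σ) (k : ℕ) (f : MvPolynomial σ F) :
    (psi T f).coeff k = fil (fun μ => ∑ v ∈ T, μ v = k) f := by
  classical
  ext μ
  rw [coeff_fil]
  induction f using MvPolynomial.induction_on' with
  | monomial ν a =>
    rw [psi_monomial, Polynomial.coeff_monomial, coeff_monomial]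
    by_cases h : ν = μ
    · subst h
      split_ifs <;> simp_all [coeff_monomial]
    · split_ifs <;> simp [h, coeff_monomial]
  | add p q hp hq =>
    rw [map_add, Polynomial.coeff_add, coeff_add, hp, hq, coeff_add]
    split_ifs <;> simp

/-- shift the variables in `T` by `p` -/
noncomputable def tau (T : Finset σ) (p : σ → F) : MvPolynomial σ F →ₐ[F] MvPolynomial σ F :=
  aeval (fun v => if v ∈ T then X v + C (p v) else X v)

/-- evaluate the variables in `T` at `p` -/
noncomputable def evT (T : Finset σ) (p : σ → F) : MvPolynomial σ F →ₐ[F] MvPolynomial σ F :=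
  aeval (fun v => if v ∈ T then C (p v) else X v)

theorem psi_tau (T U : Finset σ) (h : Disjoint T U) (p : σ → F) (f : MvPolynomial σ F) :
    psi T (tau U p f) = Polynomial.map (tau U p : MvPolynomial σ F →+* MvPolynomial σ F) (psi T f) := by
  have : ((psi T).comp (tau U p) : MvPolynomial σ F →ₐ[F] _) =
      (Polynomial.mapAlgHom (tau U p)).comp (psi T) := by
    apply MvPolynomial.algHom_ext
    intro v
    by_cases hT : v ∈ T
    · have hU : v ∉ U := Finset.disjoint_left.1 h hT
      simp [psi, tau, hT, hU]
    · by_cases hU : v ∈ U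
      · simp [psi, tau, hT, hU]
      · simp [psi, tau, hT, hU]
  exact DFunLike.congr_fun this f

theorem psi_evT (T U : Finset σ) (h : Disjoint T U) (p : σ → F) (f : MvPolynomial σ F) :
    psi T (evT U p f) = Polynomial.map (evT U p : MvPolynomial σ F →+* MvPolynomial σ F) (psi T f) := by
  have : ((psi T).comp (evT U p) : MvPolynomial σ F →ₐ[F] _) =
      (Polynomial.mapAlgHom (evT U p)).comp (psi T) := by
    apply MvPolynomial.algHom_ext
    intro v
    by_cases hT : v ∈ T
    · have hU : v ∉ U := Finset.disjoint_left.1 h hT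
      simp [psi, evT, hT, hU]
    · by_cases hU : v ∈ U
      · simp [psi, evT, hT, hU]
      · simp [psi, evT, hT, hU]
  exact DFunLike.congr_fun this f

theorem coeff_zero_psi_tau (T : Finset σ) (p : σ → F) (f : MvPolynomial σ F) :
    (psi T (tau T p f)).coeff 0 = evT T p f := by
  have : (Polynomial.constantCoeff (R := MvPolynomial σ F)).comp
      (((psi T).comp (tau T p) : MvPolynomial σ F →ₐ[F] _) : MvPolynomial σ F →+* _) =
      (evT T p : MvPolynomial σ F →+* MvPolynomial σ F) := by
    apply MvPolynomial.ringHom_ext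
    · intro a
      simp
    · intro v
      by_cases hT : v ∈ T
      · simp [psi, tau, evT, hT]
      · simp [psi, tau, evT, hT]
  exact DFunLike.congr_fun this f

/-- polynomial in a single variable -/
noncomputable def chi (v : σ) : MvPolynomial σ F →ₐ[F] Polynomial (MvPolynomial σ F) :=
  aeval (fun u => if u = v then Polynomial.X else Polynomial.C (X u))

theorem chi_monomial (v : σ) (ν : σ →₀ ℕ) (a : F) :
    chi v (monomial ν a) = Polynomial.monomial (ν v) (monomial (ν.erase v) a) := by
  rw [chi, aeval_monomial, monomial_eq (a := a) (s := ν.erase v),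
    Finsupp.prod_fintype _ _ (by simp), Finsupp.prod_fintype _ _ (by simp)]
  have h1 : ∀ u, (if u = v then Polynomial.X else
      Polynomial.C (X u) : Polynomial (MvPolynomial σ F)) ^ ν u =
      Polynomial.X ^ (if u = v then ν u else 0) * Polynomial.C (X u ^ (ν.erase v) u) := by
    intro u
    split_ifs with h
    · simp [h]
    · simp [h]
  simp only [h1]
  rw [Finset.prod_mul_distrib, Finset.prod_pow_eq_pow_sum, ← map_prod, 
    ← Polynomial.C_mul_X_pow_eq_monomial, map_mul]
  have : algebraMap F (Polynomial (MvPolynomial σ F)) a = Polynomial.C (C a) := rfl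
  rw [this, Finset.sum_ite_eq' Finset.univ v]
  simp only [Finset.mem_univ, if_true]
  ring

theorem coeff_chi (v : σ) (j : ℕ) (f : MvPolynomial σ F) (μ : σ →₀ ℕ) (hμ : μ v = 0) :
    coeff μ ((chi v f).coeff j) = coeff (μ + Finsupp.single v j) f := by
  classical
  induction f using MvPolynomial.induction_on' with
  | monomial ν a =>
    rw [chi_monomial, Polynomial.coeff_monomial, coeff_monomial]
    have : (ν = μ + Finsupp.single v j) ↔ (ν v = j ∧ ν.erase v = μ) := by
      constructor
      · rintro rfl
        refine ⟨by simp [hμ], ?_⟩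
        ext u
        by_cases h : u = v
        · subst h; simp [hμ]
        · simp [h]
      · rintro ⟨rfl, rfl⟩
        exact (Finsupp.erase_add_single v ν).symm
    by_cases h1 : ν v = j <;> by_cases h2 : ν.erase v = μ <;> simp [this, h1, h2]
  | add p q hp hq =>
    rw [map_add, Polynomial.coeff_add, coeff_add, hp, hq, coeff_add]

theorem chi_tau (v : σ) (p : σ → F) (f : MvPolynomial σ F) :
    chi v (tau {v} p f) = Polynomial.taylor (C (p v)) (chi v f) := by
  have : ((chi v).comp (tau {v} p)).toRingHom =
      (Polynomial.compRingHom (Polynomial.X + Polynomial.C (C (p v)))).comp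
        (chi v : MvPolynomial σ F →ₐ[F] Polynomial (MvPolynomial σ F)).toRingHom := by
    apply MvPolynomial.ringHom_ext
    · intro a
      have : algebraMap F (Polynomial (MvPolynomial σ F)) a = Polynomial.C (C a) := rfl
      simp [this]
    · intro u
      by_cases hT : u = v
      · subst hT
        simp [chi, tau]
      · simp [chi, tau, hT]
  rw [Polynomial.taylor_apply]
  exact DFunLike.congr_fun this f

theorem exists_root_mult [Fintype F] (u : Polynomial F) :
    ∃ c : F, Fintype.card F * u.rootMultiplicity c ≤ u.natDegree := by
  classical
  by_contra hcon
  push Not at hcon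
  have h1 : ∑ c : F, u.rootMultiplicity c ≤ u.natDegree := by
    calc ∑ c : F, u.rootMultiplicity c = ∑ c : F, u.roots.count c := by simp
      _ = Multiset.card u.roots := Multiset.sum_count_eq_card (by simp)
      _ ≤ _ := Polynomial.card_roots' u
  have h2 : ∑ c : F, u.natDegree < ∑ c : F, Fintype.card F * u.rootMultiplicity c :=
    Finset.sum_lt_sum_of_nonempty Finset.univ_nonempty fun c _ => hcon c
  rw [← Finset.mul_sum] at h2
  simp at h2
  have := lt_of_mul_lt_mul_left h2 (by positivity)
  omega

theorem coeff_taylor_slice (μ : σ →₀ ℕ) (P : Polynomial (MvPolynomial σ F)) (u : Polynomial F)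
    (hu : ∀ j, u.coeff j = coeff μ (P.coeff j)) (c : F) (l : ℕ) :
    coeff μ ((Polynomial.taylor (C c) P).coeff l) = (Polynomial.taylor c u).coeff l := by
  rw [Polynomial.taylor_coeff, Polynomial.taylor_coeff]
  set N := max (Polynomial.hasseDeriv l P).natDegree (Polynomial.hasseDeriv l u).natDegree + 1
  rw [Polynomial.eval_eq_sum_range' (n := N) (by simp only [N]; omega),
    Polynomial.eval_eq_sum_range' (n := N) (by simp only [N]; omega), coeff_sum]
  refine Finset.sum_congr rfl fun i _ => ?_
  rw [Polynomial.hasseDeriv_coeff, Polynomial.hasseDeriv_coeff, hu, ← C_pow, mul_comm _ (C _),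
    coeff_C_mul, ← map_natCast (C : F →+* MvPolynomial σ F), coeff_C_mul]
  ring

theorem sz_mult [Fintype F] (T : Finset σ) : ∀ (f : MvPolynomial σ F) (_ : f ≠ 0) (D : ℕ)
    (_ : ∀ μ ∈ f.support, ∑ v ∈ T, μ v ≤ D),
    ∃ p : σ → F, ∃ μ ∈ (tau T p f).support, Fintype.card F * ∑ v ∈ T, μ v ≤ D := by
  classical
  induction T using Finset.induction_on with
  | empty =>
    intro f hf D _
    obtain ⟨μ, hμ⟩ := MvPolynomial.ne_zero_iff.1 hf
    refine ⟨0, μ, ?_, by simp⟩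
    have : tau (F := F) (∅ : Finset σ) 0 f = f := by
      have : tau (F := F) (∅ : Finset σ) 0 = AlgHom.id F _ := by
        apply MvPolynomial.algHom_ext; intro v; simp [tau]
      rw [this]; rfl
    rw [this]
    simpa using hμ
  | insert v T hv ih =>
    intro f hf D hD
    set k := f.degreeOf v with hk
    set G := fil (fun μ => ∑ u ∈ {v}, μ u = k) f with hG
    have hne : f.support.Nonempty := by simpa using hf
    have hGne : G ≠ 0 := by
      obtain ⟨μ, hμ, hμk⟩ := Finset.exists_mem_eq_sup _ hne (fun m => m v)
      rw [← degreeOf_eq_sup] at hμk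
      rw [MvPolynomial.ne_zero_iff]
      refine ⟨μ, ?_⟩
      rw [hG, coeff_fil, if_pos (by simp [hk, hμk])]
      simpa using hμ
    have hkD : ∀ μ ∈ G.support, ∑ u ∈ T, μ u + k ≤ D := by
      intro μ hμ
      rw [mem_support_iff, hG, coeff_fil] at hμ
      split_ifs at hμ with h
      · have := hD μ (by simpa using hμ)
        rw [Finset.sum_insert hv] at this
        simp at h
        omega
      · exact absurd rfl hμ
    obtain ⟨p', μ', hμ', hcard⟩ := ih G hGne (D - k) (fun μ hμ => by
      have := hkD μ hμ; omega)
    have hDk : k ≤ D := by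
      obtain ⟨μ, hμ⟩ := MvPolynomial.ne_zero_iff.1 hGne
      have := hkD μ (by simpa using hμ)
      omega
    have hdis : Disjoint {v} T := by simpa using hv
    set h := tau T p' f with hh
    have hcomm : ∀ j, tau T p' (fil (fun μ => ∑ u ∈ {v}, μ u = j) f) =
        fil (fun μ => ∑ u ∈ {v}, μ u = j) h := by
      intro j
      rw [← coeff_psi, ← coeff_psi, hh, psi_tau _ _ hdis, Polynomial.coeff_map]
      rfl
    rw [mem_support_iff, hG, hcomm, coeff_fil] at hμ'
    have hμk : μ' v = k := by
      by_contra hcon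
      rw [if_neg (by simpa using hcon)] at hμ'
      exact hμ' rfl
    rw [if_pos (by simpa using hμk)] at hμ'
    have hbig : ∀ μ : σ →₀ ℕ, k < μ v → coeff μ h = 0 := by
      intro μ hlt
      have h1 : fil (fun ν => ∑ u ∈ {v}, ν u = μ v) f = 0 := by
        ext ν
        rw [coeff_fil, coeff_zero]
        split_ifs with hc
        · simp at hc
          by_contra hne
          have := monomial_le_degreeOf v (show ν ∈ f.support by simpa using hne)
          omega
        · rfl
      have h2 := hcomm (μ v)
      rw [h1, map_zero] at h2
      have h3 := congrArg (coeff μ) h2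
      rw [coeff_fil, if_pos (by simp), coeff_zero] at h3
      exact h3.symm
    set μ0 := μ'.erase v with hμ0
    have hμ0v : μ0 v = 0 := by simp [hμ0]
    let u : Polynomial F := ∑ j ∈ Finset.range (k + 1),
      Polynomial.monomial j (coeff (μ0 + Finsupp.single v j) h)
    have hu : ∀ j, u.coeff j = coeff μ0 ((chi v h).coeff j) := by
      intro j
      rw [coeff_chi _ _ _ _ hμ0v]
      simp only [u, Polynomial.finsetSum_coeff, Polynomial.coeff_monomial]
      rw [Finset.sum_ite_eq']
      split_ifs with hj
      · rfl
      · rw [hbig]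
        simp [hμ0v]
        simpa using hj
    have hune : u ≠ 0 := by
      intro h0
      apply hμ'
      have := hu k
      rw [h0, coeff_chi _ _ _ _ hμ0v, ← hμk, hμ0] at this
      rw [Finsupp.erase_add_single, Polynomial.coeff_zero] at this
      exact this.symm
    have hudeg : u.natDegree ≤ k := by
      apply Polynomial.natDegree_sum_le_of_forall_le
      intro j hj
      refine (Polynomial.natDegree_monomial_le _).trans ?_
      simp at hj
      omega
    obtain ⟨c, hc⟩ := exists_root_mult u
    set l := u.rootMultiplicity c with hl
    have hlne : (Polynomial.taylor c u).coeff l ≠ 0 := by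
      rw [hl, Polynomial.rootMultiplicity_eq_natTrailingDegree, ← Polynomial.taylor_apply]
      change (Polynomial.taylor c u).trailingCoeff ≠ 0
      rw [Ne, Polynomial.trailingCoeff_eq_zero]
      intro h0
      exact hune (Polynomial.taylor_injective c (by simpa using h0))
    rw [← coeff_taylor_slice μ0 (chi v h) u hu] at hlne
    have hp : c = (Function.update p' v c) v := by simp
    rw [hp, ← chi_tau, coeff_chi _ _ _ _ hμ0v] at hlne
    have hcomp : tau {v} (Function.update p' v c) h = tau (insert v T) (Function.update p' v c) f := by
      have : (tau {v} (Function.update p' v c)).comp (tau T p') =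
          tau (insert v T) (Function.update p' v c) := by
        apply MvPolynomial.algHom_ext
        intro w
        by_cases hw : w = v
        · subst hw
          simp [tau, hv]
        · by_cases hwT : w ∈ T <;> simp [tau, hw, hwT]
      rw [← this]; rfl
    rw [hcomp] at hlne
    refine ⟨_, _, by rw [mem_support_iff]; exact hlne, ?_⟩
    rw [Finset.sum_insert hv]
    have hs : ∑ w ∈ T, (μ0 + Finsupp.single v l) w = ∑ w ∈ T, μ' w := by
      refine Finset.sum_congr rfl fun w hw => ?_
      have : w ≠ v := fun h => hv (h ▸ hw)
      simp [hμ0, this, this.symm]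
    rw [hs]
    simp only [Finsupp.add_apply, hμ0v, Finsupp.single_eq_same, zero_add]
    rw [mul_add]
    omega

theorem block_step [Fintype F] {a b : ℕ} (T : Finset σ)
    (M : Matrix (Fin a) (Fin b) (MvPolynomial σ F))
    (hdeg : ∀ i j, (psi T (M i j)).natDegree ≤ 1) :
    ∃ p : σ → F, Fintype.card F * M.rank ≤
      Fintype.card F * (M.map (evT T p)).rank + M.rank := by
  obtain ⟨ι, κ, hdet⟩ := exists_minor M
  set A := M.submatrix ι κ with hA
  have hpsi : (psi T A.det).natDegree ≤ M.rank := by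
    have : psi T A.det = ((psi T : MvPolynomial σ F →ₐ[F] _).mapMatrix A).det :=
      AlgHom.map_det _ _
    rw [this, Matrix.det_apply]
    apply Polynomial.natDegree_sum_le_of_forall_le
    intro s _
    refine (Polynomial.natDegree_smul_le _ _).trans ?_
    refine (Polynomial.natDegree_prod_le _ _).trans ?_
    refine (Finset.sum_le_sum (g := fun _ => 1) fun i _ => hdeg _ _).trans ?_
    simp
  obtain ⟨p, μ, hμ, hcard⟩ := sz_mult T A.det hdet M.rank (by
    intro μ hμ
    refine le_trans (Polynomial.le_natDegree_of_ne_zero ?_) hpsi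
    rw [coeff_psi, MvPolynomial.ne_zero_iff]
    refine ⟨μ, ?_⟩
    rw [coeff_fil, if_pos rfl]
    simpa using hμ)
  refine ⟨p, ?_⟩
  have h1 := corank_le (m := ∑ v ∈ T, μ v) (((psi T).comp (tau T p)).mapMatrix A) (by
    rw [← AlgHom.map_det, AlgHom.comp_apply, coeff_psi, MvPolynomial.ne_zero_iff]
    refine ⟨μ, ?_⟩
    rw [coeff_fil, if_pos rfl]
    simpa using hμ)
  have h2 : (((psi T).comp (tau T p)).mapMatrix A).map (fun p => p.coeff 0) =
      (M.map (evT T p)).submatrix ι κ := by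
    ext1 i j
    simp [hA, coeff_zero_psi_tau]
  rw [h2] at h1
  have h3 := Matrix.rank_submatrix_le (M.map (evT T p)) ι κ
  have h4 : Fintype.card F * M.rank ≤ Fintype.card F * ((M.map (evT T p)).rank + ∑ v ∈ T, μ v) :=
    Nat.mul_le_mul_left _ (by omega)
  rw [mul_add] at h4
  omega

end PolyPart

section BlockPart

variable {F : Type*} [Field F] {d n : ℕ}

/-- the variables of block `i` -/
def blk (n : ℕ) {d : ℕ} (i : Fin d) : Finset (Fin d × Fin n) :=
  Finset.univ.map ⟨fun j => (i, j), fun _ _ h => (Prod.mk.inj h).2⟩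

theorem mem_blk (i : Fin d) (v : Fin d × Fin n) : v ∈ blk n i ↔ v.1 = i := by
  unfold blk
  simp only [Finset.mem_map, Finset.mem_univ, true_and, Function.Embedding.coeFn_mk]
  constructor
  · rintro ⟨j, rfl⟩; rfl
  · rintro rfl; exact ⟨v.2, rfl⟩

theorem sum_blk (i : Fin d) (μ : Fin d × Fin n →₀ ℕ) : ∑ v ∈ blk n i, μ v = ∑ j, μ (i, j) := by
  unfold blk
  rw [Finset.sum_map]; rfl

theorem multi_block [Fintype F] {a b : ℕ} (B : Finset (Fin d))
    (M : Matrix (Fin a) (Fin b) (MvPolynomial (Fin d × Fin n) F))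
    (hdeg : ∀ k i j, (psi (blk n k) (M i j)).natDegree ≤ 1) :
    ∃ p : Fin d × Fin n → F, (Fintype.card F - 1) ^ B.card * M.rank ≤
      Fintype.card F ^ B.card *
        (M.map (evT (Finset.univ.filter fun v => v.1 ∈ B) p)).rank := by
  classical
  induction B using Finset.induction_on with
  | empty =>
    refine ⟨0, ?_⟩
    have : evT (F := F) (Finset.univ.filter fun v : Fin d × Fin n => v.1 ∈ (∅ : Finset (Fin d))) 0
        = AlgHom.id F _ := by
      apply MvPolynomial.algHom_ext; intro v; simp [evT]
    rw [this]
    simp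
  | insert k B hk ih =>
    obtain ⟨p, hp⟩ := ih
    set U := Finset.univ.filter fun v : Fin d × Fin n => v.1 ∈ B with hU
    have hdis : Disjoint (blk n k) U := by
      rw [Finset.disjoint_left]
      intro v hv hv'
      rw [mem_blk] at hv
      simp only [hU, Finset.mem_filter, Finset.mem_univ, true_and] at hv'
      exact hk (hv ▸ hv')
    obtain ⟨p', hp'⟩ := block_step (blk n k) (M.map (evT U p)) (by
      intro i j
      rw [Matrix.map_apply, psi_evT _ _ hdis]
      exact Polynomial.natDegree_map_le.trans (hdeg k i j))
    refine ⟨fun v => if v.1 = k then p' v else p v, ?_⟩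
    have hcomp : (evT (blk n k) p').comp (evT U p) =
        evT (Finset.univ.filter fun v => v.1 ∈ insert k B)
          (fun v => if v.1 = k then p' v else p v) := by
      apply MvPolynomial.algHom_ext
      intro w
      by_cases hw : w.1 = k
      · have : w ∉ U := by simp [hU, hw, hk]
        simp [evT, mem_blk, hw, this]
      · by_cases hwB : w.1 ∈ B
        · have : w ∈ U := by simp [hU, hwB]
          simp [evT, hw, hwB, this]
        · have : w ∉ U := by simp [hU, hwB]
          simp [evT, mem_blk, hw, hwB, this]
    have hmap : (M.map (evT U p)).map (evT (blk n k) p') =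
        M.map (evT (Finset.univ.filter fun v => v.1 ∈ insert k B)
          (fun v => if v.1 = k then p' v else p v)) := by
      rw [← hcomp, Matrix.map_map]; rfl
    rw [hmap] at hp'
    rw [Finset.card_insert_of_notMem hk]
    set r := M.rank
    set r' := (M.map (evT U p)).rank
    set r'' := (M.map (evT (Finset.univ.filter fun v => v.1 ∈ insert k B)
          (fun v => if v.1 = k then p' v else p v))).rank
    obtain ⟨q, hq⟩ : ∃ q, Fintype.card F = q + 1 :=
      ⟨Fintype.card F - 1, by have := Fintype.card_pos (α := F); omega⟩
    rw [hq] at hp hp' ⊢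
    simp only [Nat.add_sub_cancel] at hp ⊢
    have h1 : q * r' ≤ (q + 1) * r'' := by
      have : (q + 1) * r' = q * r' + r' := by ring
      omega
    calc q ^ (B.card + 1) * r = q * (q ^ B.card * r) := by ring
      _ ≤ q * ((q + 1) ^ B.card * r') := Nat.mul_le_mul_left _ hp
      _ = (q + 1) ^ B.card * (q * r') := by ring
      _ ≤ (q + 1) ^ B.card * ((q + 1) * r'') := Nat.mul_le_mul_left _ h1
      _ = _ := by ring

theorem fil_fil {σ : Type*} [Fintype σ] [DecidableEq σ] (P Q : (σ →₀ ℕ) → Prop) (f : MvPolynomial σ F) :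
    fil P (fil Q f) = fil (fun μ => P μ ∧ Q μ) f := by
  classical
  ext μ
  simp only [coeff_fil]
  by_cases h1 : P μ <;> by_cases h2 : Q μ <;> simp [h1, h2]

theorem fil_congr {σ : Type*} [Fintype σ] [DecidableEq σ] (P Q : (σ →₀ ℕ) → Prop) (h : ∀ μ, P μ ↔ Q μ)
    (f : MvPolynomial σ F) : fil P f = fil Q f := by
  have : P = Q := funext fun μ => propext (h μ)
  rw [this]

theorem fil_add {σ : Type*} [Fintype σ] [DecidableEq σ] (P : (σ →₀ ℕ) → Prop) (f g : MvPolynomial σ F) :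
    fil P (f + g) = fil P f + fil P g := by
  classical
  ext μ
  simp only [coeff_fil, coeff_add]
  split_ifs <;> simp

theorem fil_zero {σ : Type*} [Fintype σ] [DecidableEq σ] (P : (σ →₀ ℕ) → Prop) :
    fil P (0 : MvPolynomial σ F) = 0 := by
  classical
  ext μ
  simp [coeff_fil]

theorem fil_sum {σ : Type*} [Fintype σ] [DecidableEq σ] {I : Type*} (P : (σ →₀ ℕ) → Prop) (s : Finset I)
    (f : I → MvPolynomial σ F) :
    fil P (∑ i ∈ s, f i) = ∑ i ∈ s, fil P (f i) := by
  classical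
  ext μ
  simp only [coeff_fil, coeff_sum]
  split_ifs <;> simp

theorem rank_theta {a b : ℕ} (i : Fin d)
    (E : Matrix (Fin a) (Fin b) (MvPolynomial (Fin d × Fin n) F)) :
    (E.map (fil fun μ => ∑ j, μ (i, j) = 1)).rank ≤
      E.rank + (E.map (fil fun μ => ∑ j, μ (i, j) = 0)).rank := by
  have h1 := rank_coeff_one_le (E.map (psi (blk n i)))
  have h2 := rank_map_le' E (psi (F := F) (blk n i)).toRingHom
  have e : ∀ k, (E.map (psi (blk n i))).map (fun p => p.coeff k) =
      E.map (fil fun μ => ∑ j, μ (i, j) = k) := by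
    intro k
    ext1 x y
    simp only [Matrix.map_apply, coeff_psi, sum_blk]
  rw [e, e] at h1
  refine h1.trans ?_
  gcongr
  exact h2

theorem rank_zeta {a b : ℕ} (i : Fin d)
    (E : Matrix (Fin a) (Fin b) (MvPolynomial (Fin d × Fin n) F)) :
    (E.map (fil fun μ => ∑ j, μ (i, j) = 0)).rank ≤ E.rank := by
  have h2 := rank_map_le' E (Polynomial.constantCoeff.comp (psi (F := F) (blk n i)).toRingHom)
  have e : E.map (Polynomial.constantCoeff.comp (psi (F := F) (blk n i)).toRingHom) =
      E.map (fil fun μ => ∑ j, μ (i, j) = 0) := by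
    ext1 x y
    simp only [Matrix.map_apply, ← sum_blk, ← coeff_psi]
    rfl
  rwa [e] at h2

theorem map_fil_fil {a b : ℕ} {σ : Type*} [Fintype σ] [DecidableEq σ] (P Q R : (σ →₀ ℕ) → Prop)
    (h : ∀ μ, (P μ ∧ Q μ) ↔ R μ)
    (E : Matrix (Fin a) (Fin b) (MvPolynomial σ F)) :
    (E.map (fil Q)).map (fil P) = E.map (fil R) := by
  ext1 x y
  simp only [Matrix.map_apply, fil_fil]
  exact fil_congr _ _ h _

theorem map_fil_true {a b : ℕ} {σ : Type*} [Fintype σ] [DecidableEq σ] (R : (σ →₀ ℕ) → Prop)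
    (h : ∀ μ, R μ)
    (E : Matrix (Fin a) (Fin b) (MvPolynomial σ F)) :
    E.map (fil R) = E := by
  classical
  ext1 x y
  ext μ
  simp [coeff_fil, h]

theorem rank_zB {a b : ℕ} (B : Finset (Fin d))
    (E : Matrix (Fin a) (Fin b) (MvPolynomial (Fin d × Fin n) F)) :
    (E.map (fil fun μ => ∀ i ∈ B, ∑ j, μ (i, j) = 0)).rank ≤ E.rank := by
  classical
  induction B using Finset.induction_on with
  | empty => rw [map_fil_true _ (by simp)]
  | insert k B hk ih =>
    rw [← map_fil_fil (fun μ => ∑ j, μ (k, j) = 0) (fun μ => ∀ i ∈ B, ∑ j, μ (i, j) = 0) _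
      (by intro μ; rw [Finset.forall_mem_insert])]
    exact (rank_zeta _ _).trans ih

theorem rank_compB {a b : ℕ} (B : Finset (Fin d)) :
    ∀ E : Matrix (Fin a) (Fin b) (MvPolynomial (Fin d × Fin n) F),
    (E.map (fil fun μ => ∀ i ∈ B, ∑ j, μ (i, j) = 1)).rank ≤
      (2 ^ B.card - 1) * E.rank + (E.map (fil fun μ => ∀ i ∈ B, ∑ j, μ (i, j) = 0)).rank := by
  classical
  induction B using Finset.induction_on with
  | empty =>
    intro E
    rw [map_fil_true _ (by simp), map_fil_true _ (by simp)]
    simp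
  | insert k B hk ih =>
    intro E
    set Θ := E.map (fil fun μ => ∑ j, μ (k, j) = 1) with hΘ
    set z := E.map (fil fun μ => ∀ i ∈ B, ∑ j, μ (i, j) = 0) with hz
    have e1 : Θ.map (fil fun μ => ∀ i ∈ B, ∑ j, μ (i, j) = 1) =
        E.map (fil fun μ => ∀ i ∈ insert k B, ∑ j, μ (i, j) = 1) := by
      apply map_fil_fil
      intro μ; rw [Finset.forall_mem_insert, and_comm]
    have e2 : z.map (fil fun μ => ∑ j, μ (k, j) = 0) =
        E.map (fil fun μ => ∀ i ∈ insert k B, ∑ j, μ (i, j) = 0) := by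
      apply map_fil_fil
      intro μ; rw [Finset.forall_mem_insert]
    have e3 : Θ.map (fil fun μ => ∀ i ∈ B, ∑ j, μ (i, j) = 0) =
        z.map (fil fun μ => ∑ j, μ (k, j) = 1) := by
      rw [hΘ, hz, map_fil_fil _ _ _ (fun μ => Iff.rfl), map_fil_fil _ _ _ (fun μ => and_comm)]
    have h1 := ih Θ
    rw [e1, e3] at h1
    have h2 := rank_theta k z
    rw [e2] at h2
    have h3 : z.rank ≤ E.rank := rank_zB B E
    have h4 : Θ.rank ≤ 2 * E.rank := by
      have h7 := rank_theta k E
      rw [← hΘ] at h7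
      have := rank_zeta k E
      omega
    have h5 : (2 ^ B.card - 1) * Θ.rank ≤ (2 ^ B.card - 1) * (2 * E.rank) :=
      Nat.mul_le_mul_left _ h4
    have h6 : (2 ^ (insert k B).card - 1) * E.rank =
        (2 ^ B.card - 1) * (2 * E.rank) + E.rank := by
      rw [Finset.card_insert_of_notMem hk, pow_succ]
      have : 1 ≤ 2 ^ B.card := Nat.one_le_two_pow
      obtain ⟨t, ht⟩ := Nat.exists_eq_add_of_le this
      rw [ht]
      have e : (1 + t) * 2 - 1 = 2 * t + 1 := by omega
      rw [e, Nat.add_sub_cancel_left]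
      ring
    omega

end BlockPart

section FinalPart

variable {F : Type*} [Field F] {d n : ℕ}

/-- the component which is multilinear exactly in the blocks of `S` -/
noncomputable def compS (S : Finset (Fin d)) (f : MvPolynomial (Fin d × Fin n) F) :
    MvPolynomial (Fin d × Fin n) F :=
  fil (fun μ => ∀ i, ∑ j, μ (i, j) = if i ∈ S then 1 else 0) f

theorem compS_multilinear (S : Finset (Fin d)) (f : MvPolynomial (Fin d × Fin n) F) :
    IsMultilinearOn S (compS S f) := by
  intro m hm
  rw [mem_support_iff, compS, coeff_fil] at hm
  by_contra h
  rw [if_neg h] at hm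
  exact hm rfl

theorem compS_univ_mul (f g : MvPolynomial (Fin d × Fin n) F) :
    compS Finset.univ (f * g) = ∑ S : Finset (Fin d), compS S f * compS Sᶜ g := by
  classical
  ext μ
  rw [compS, coeff_fil, coeff_sum]
  simp only [coeff_mul, compS, coeff_fil]
  rw [Finset.sum_comm]
  have key : ∀ x ∈ Finset.HasAntidiagonal.antidiagonal μ,
      ∑ S : Finset (Fin d), ((if ∀ i, ∑ j, x.1 (i, j) = if i ∈ S then 1 else 0 then coeff x.1 f
        else 0) * (if ∀ i, ∑ j, x.2 (i, j) = if i ∈ Sᶜ then 1 else 0 then coeff x.2 g else 0)) =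
      if ∀ i, ∑ j, μ (i, j) = if i ∈ (Finset.univ : Finset (Fin d)) then 1 else 0
        then coeff x.1 f * coeff x.2 g else 0 := by
    intro x hx
    rw [Finset.HasAntidiagonal.mem_antidiagonal] at hx
    have hsum : ∀ i, ∑ j, μ (i, j) = ∑ j, x.1 (i, j) + ∑ j, x.2 (i, j) := by
      intro i
      rw [← hx, ← Finset.sum_add_distrib]; rfl
    by_cases hμ : ∀ i, ∑ j, μ (i, j) = if i ∈ (Finset.univ : Finset (Fin d)) then 1 else 0
    · rw [if_pos hμ]
      simp only [Finset.mem_univ, if_true] at hμ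
      rw [Finset.sum_eq_single (Finset.univ.filter fun i => ∑ j, x.1 (i, j) = 1)]
      · rw [if_pos, if_pos]
        · intro i
          have h1 := hμ i
          rw [hsum] at h1
          simp only [Finset.mem_compl, Finset.mem_filter, Finset.mem_univ, true_and]
          split_ifs <;> omega
        · intro i
          have h1 := hμ i
          rw [hsum] at h1
          simp only [Finset.mem_filter, Finset.mem_univ, true_and]
          split_ifs <;> omega
      · intro S _ hS
        rw [if_neg, zero_mul]
        intro hcon
        apply hS
        ext i
        simp only [Finset.mem_filter, Finset.mem_univ, true_and]
        rw [hcon i]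
        by_cases hi : i ∈ S <;> simp [hi]
      · simp
    · rw [if_neg hμ]
      apply Finset.sum_eq_zero
      intro S _
      by_contra hne
      apply hμ
      intro i
      have h1 : ∀ i, ∑ j, x.1 (i, j) = if i ∈ S then 1 else 0 := by
        by_contra h; rw [if_neg h, zero_mul] at hne; exact hne rfl
      have h2 : ∀ i, ∑ j, x.2 (i, j) = if i ∈ Sᶜ then 1 else 0 := by
        by_contra h; rw [if_neg h, mul_zero] at hne; exact hne rfl
      rw [hsum, h1, h2]
      by_cases hi : i ∈ S <;> simp [hi]
  refine Eq.trans ?_ (Finset.sum_congr rfl (fun x hx => Eq.trans (key x hx).symm ?_))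
  · split_ifs <;> simp
  · refine Finset.sum_congr rfl fun S _ => ?_
    congr

theorem hasPR_of_fintype {a b : ℕ} {I : Type*} [Fintype I]
    (M : Matrix (Fin a) (Fin b) (MvPolynomial (Fin d × Fin n) F))
    (S : I → Finset (Fin d))
    (u : I → Fin a → MvPolynomial (Fin d × Fin n) F)
    (v : I → Fin b → MvPolynomial (Fin d × Fin n) F)
    (hu : ∀ t i, IsMultilinearOn (S t) (u t i))
    (hv : ∀ t j, IsMultilinearOn (S t)ᶜ (v t j))
    (hM : M = ∑ t, Matrix.of fun i j => u t i * v t j) :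
    HasPRDecomp M (Fintype.card I) := by
  let e := Fintype.equivFin I
  refine ⟨fun t => S (e.symm t), fun t => u (e.symm t), fun t => v (e.symm t),
    fun t => hu _, fun t => hv _, ?_⟩
  rw [hM]
  exact (Equiv.sum_comp e.symm (fun t => Matrix.of fun i j => u t i * v t j)).symm

theorem hasPR_add {a b : ℕ} {I : Type*} [Fintype I] {r : ℕ}
    (M N : Matrix (Fin a) (Fin b) (MvPolynomial (Fin d × Fin n) F))
    (S : I → Finset (Fin d))
    (u : I → Fin a → MvPolynomial (Fin d × Fin n) F)
    (v : I → Fin b → MvPolynomial (Fin d × Fin n) F)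
    (hu : ∀ t i, IsMultilinearOn (S t) (u t i))
    (hv : ∀ t j, IsMultilinearOn (S t)ᶜ (v t j))
    (hN : HasPRDecomp N r)
    (hM : M = N + ∑ t, Matrix.of fun i j => u t i * v t j) :
    HasPRDecomp M (Fintype.card I + r) := by
  obtain ⟨S', u', v', hu', hv', rfl⟩ := hN
  have := hasPR_of_fintype M (I := I ⊕ Fin r) (Sum.elim S S') (Sum.elim u u') (Sum.elim v v')
    (by rintro (t | t) i; exacts [hu t i, hu' t i])
    (by rintro (t | t) i; exacts [hv t i, hv' t i])
    (by rw [hM, Fintype.sum_sum_type, add_comm]; rfl)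
  simpa using this

theorem eq_zero_of_rank {B : Type*} [CommRing B] [IsDomain B] {a b : ℕ}
    (M : Matrix (Fin a) (Fin b) B) (h : M.rank = 0) : M = 0 := by
  ext i j
  by_contra hne
  have := le_rank_of_minor (r := 1) M (fun _ => i) (fun _ => j) (by simpa using hne)
  omega

section General

variable {σ : Type*} [Fintype σ] [DecidableEq σ]

theorem evT_univ (p : σ → F) (f : MvPolynomial σ F) :
    evT Finset.univ p f = C (eval p f) := by
  have : evT Finset.univ p = (Algebra.ofId F (MvPolynomial σ F)).comp (aeval p) := by
    apply MvPolynomial.algHom_ext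
    intro v
    simp [evT, Algebra.ofId_apply]
  rw [this]
  simp [Algebra.ofId_apply, aeval_eq_eval]

theorem top_monomial (p : σ → F) (ν : σ →₀ ℕ) :
    (psi Finset.univ (tau Finset.univ p (monomial ν (1 : F)))).natDegree ≤ ∑ v, ν v ∧
    (psi Finset.univ (tau Finset.univ p (monomial ν (1 : F)))).coeff (∑ v, ν v) =
      monomial ν 1 := by
  induction ν using Finsupp.induction_linear with
  | zero =>
    have : (monomial (0 : σ →₀ ℕ) (1 : F)) = 1 := rfl
    rw [this]
    simp
  | add μ ν hμ hν =>
    have h1 : monomial (μ + ν) (1 : F) = monomial μ 1 * monomial ν 1 := by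
      rw [monomial_mul, one_mul]
    have h2 : ∑ v, (μ + ν) v = ∑ v, μ v + ∑ v, ν v := by
      rw [← Finset.sum_add_distrib]; rfl
    rw [h1, h2, map_mul, map_mul]
    refine ⟨Polynomial.natDegree_mul_le_of_le hμ.1 hν.1, ?_⟩
    rw [Polynomial.coeff_mul_add_eq_of_natDegree_le hμ.1 hν.1, hμ.2, hν.2]
  | single v k =>
    have h1 : monomial (Finsupp.single v k) (1 : F) = X v ^ k := by
      rw [X_pow_eq_monomial]
    have h2 : ∑ w, (Finsupp.single v k) w = k := by
      simp [Finsupp.single_apply]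
    have h3 : psi Finset.univ (tau Finset.univ p (X v : MvPolynomial σ F)) =
        Polynomial.C (X v) * Polynomial.X + Polynomial.C (C (p v)) := by
      simp [psi, tau]
    rw [h1, h2, map_pow, map_pow, h3]
    have h4 : (Polynomial.C (X v) * Polynomial.X + Polynomial.C (C (p v)) :
      Polynomial (MvPolynomial σ F)).natDegree ≤ 1 := Polynomial.natDegree_linear_le
    have h5 := Polynomial.natDegree_pow_le_of_le k h4
    have h6 := Polynomial.coeff_pow_of_natDegree_le (n := 1) (m := k) h4
    rw [mul_one] at h5
    refine ⟨h5, ?_⟩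
    simpa using h6

theorem top_coeff (p : σ → F) (D : ℕ) (f : MvPolynomial σ F)
    (hf : ∀ μ ∈ f.support, ∑ v, μ v = D) :
    (psi Finset.univ (tau Finset.univ p f)).coeff D = f := by
  conv_lhs => rw [f.as_sum]
  conv_rhs => rw [f.as_sum]
  rw [map_sum, map_sum, Polynomial.finsetSum_coeff]
  refine Finset.sum_congr rfl fun μ hμ => ?_
  have h1 : monomial μ (coeff μ f) = coeff μ f • monomial μ (1 : F) := by
    rw [smul_monomial, smul_eq_mul, mul_one]
  rw [h1, map_smul, map_smul, Polynomial.coeff_smul, ← hf μ hμ, (top_monomial p μ).2]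

end General

theorem compS_univ_total (f : MvPolynomial (Fin d × Fin n) F) :
    compS Finset.univ ((psi Finset.univ f).coeff d) = compS Finset.univ f := by
  rw [coeff_psi, compS, fil_fil]
  apply fil_congr
  intro μ
  constructor
  · exact fun h => h.1
  · intro h
    refine ⟨h, ?_⟩
    rw [Fintype.sum_prod_type, Finset.sum_congr rfl (fun i _ => h i)]
    simp

theorem compS_univ_self (f : MvPolynomial (Fin d × Fin n) F) (hf : IsMultilinear f) :
    compS Finset.univ f = f := by
  classical
  ext μ
  rw [compS, coeff_fil]
  split_ifs with h
  · rfl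
  · by_contra hne
    exact h (hf μ (by rw [mem_support_iff]; exact fun h => hne h.symm))

theorem compS_univ_tau (p : Fin d × Fin n → F) (f : MvPolynomial (Fin d × Fin n) F)
    (hf : IsMultilinear f) : compS Finset.univ (tau Finset.univ p f) = f := by
  rw [← compS_univ_total, top_coeff p d f, compS_univ_self f hf]
  intro μ hμ
  rw [Fintype.sum_prod_type, Finset.sum_congr rfl (fun i _ => hf μ hμ i)]
  simp

theorem compS_univ_pow_mul (g h : MvPolynomial (Fin d × Fin n) F)
    (hg : (psi Finset.univ g).coeff 0 = 0) : compS Finset.univ (g ^ (d + 1) * h) = 0 := by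
  have h1 : Polynomial.X ^ (d + 1) ∣ psi Finset.univ (g ^ (d + 1) * h) := by
    rw [map_mul, map_pow]
    exact (pow_dvd_pow_of_dvd (Polynomial.X_dvd_iff.2 hg) _).mul_right _
  rw [← compS_univ_total, (Polynomial.X_pow_dvd_iff.1 h1) d (by omega)]
  exact fil_zero _

end FinalPart

section LastPart

variable {F : Type*} [Field F] {d n : ℕ}

theorem rank_smul_le_aux {B : Type*} [CommRing B] [IsDomain B] {a b : ℕ} (c : B)
    (E : Matrix (Fin a) (Fin b) B) : (c • E).rank ≤ E.rank := by
  have : c • E = E * (Matrix.diagonal (fun _ => c) : Matrix (Fin b) (Fin b) B) := by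
    ext i j
    rw [Matrix.mul_diagonal, Matrix.smul_apply, smul_eq_mul, mul_comm]
  rw [this]
  exact Matrix.rank_mul_le_left _ _

theorem smul_schur_entry {B : Type*} [CommRing B] {a b s : ℕ} (δ' δ : B)
    (Mt : Matrix (Fin a) (Fin b) B) (Y : Matrix (Fin a) (Fin s) B) (Z : Matrix (Fin s) (Fin b) B)
    (i : Fin a) (j : Fin b) :
    (δ' • (δ • Mt - Y * Z)) i j = δ' * δ * Mt i j - ∑ l, Y i l * (δ' • Z) l j := by
  simp only [Matrix.smul_apply, Matrix.sub_apply, Matrix.mul_apply, smul_eq_mul, mul_sub,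
    Finset.mul_sum, ← mul_assoc]
  congr 1
  refine Finset.sum_congr rfl fun l _ => ?_
  ring

theorem core_step {a b : ℕ} (M : Matrix (Fin a) (Fin b) (MvPolynomial (Fin d × Fin n) F))
    (hM : ∀ i j, IsMultilinear (M i j)) (p : Fin d × Fin n → F) :
    ∃ N : Matrix (Fin a) (Fin b) (MvPolynomial (Fin d × Fin n) F),
      (∀ i j, IsMultilinear (N i j)) ∧
      N.rank ≤ (2 ^ d - 1) * (M.rank - (M.map (evT Finset.univ p)).rank) ∧
      ∀ r, HasPRDecomp N r → HasPRDecomp M (2 ^ d * (M.map (evT Finset.univ p)).rank + r) := by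
  classical
  set Mp := M.map (evT Finset.univ p) with hMp
  obtain ⟨s, hs⟩ : ∃ s, s = Mp.rank := ⟨_, rfl⟩
  obtain ⟨ι, κ, hdet⟩ : ∃ (ι : Fin s → Fin a) (κ : Fin s → Fin b),
      (Mp.submatrix ι κ).det ≠ 0 := by
    rw [hs]
    exact exists_minor Mp
  rw [← hs]
  set Mt := M.map (tau Finset.univ p) with hMt
  let ε : MvPolynomial (Fin d × Fin n) F →+* MvPolynomial (Fin d × Fin n) F :=
    Polynomial.constantCoeff.comp (psi (F := F) Finset.univ).toRingHom
  have hε : ∀ f, ε f = (psi Finset.univ f).coeff 0 := fun f => rfl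
  have hεM : Mt.map ε = Mp := by
    ext1 i j
    simp only [hMt, hMp, Matrix.map_apply, hε, coeff_zero_psi_tau]
  have hεM' : ∀ i j, ε (Mt i j) = Mp i j := fun i j => by rw [← hεM]; rfl
  have hεC : ∀ c : F, ε (C c) = C c := by
    intro c
    rw [hε, ← algebraMap_eq, AlgHom.commutes]
    simp [Polynomial.algebraMap_apply]
  set A := Mt.submatrix ι κ with hA
  set δ := A.det with hδ
  have hεA : ε.mapMatrix A = Mp.submatrix ι κ := by
    ext1 i j
    simp [hA, hεM']
  have hεδ : ε δ = (Mp.submatrix ι κ).det := by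
    rw [hδ, RingHom.map_det, hεA]
  have hεadj : ∀ i j, ε (A.adjugate i j) = (Mp.submatrix ι κ).adjugate i j := by
    intro i j
    have := RingHom.map_adjugate ε A
    rw [hεA] at this
    rw [← this]; rfl
  obtain ⟨c, hc⟩ : ∃ c : F, ε δ = C c := by
    refine ⟨eval p (M.submatrix ι κ).det, ?_⟩
    rw [hεδ, ← evT_univ, AlgHom.map_det]
    rfl
  have hc0 : c ≠ 0 := by
    rintro rfl
    apply hdet
    rw [← hεδ, hc, C_0]
  have hδ0 : δ ≠ 0 := by
    intro h
    rw [← hεδ, h, map_zero] at hdet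
    exact hdet rfl
  set g := 1 - C c⁻¹ * δ with hg
  have hεg : ε g = 0 := by
    rw [hg, map_sub, map_one, map_mul, hc, hεC, ← C_mul, inv_mul_cancel₀ hc0, C_1, sub_self]
  set δ' := C c⁻¹ * ∑ k ∈ Finset.range (d + 1), g ^ k with hδ'
  have hδδ' : δ' * δ = 1 - g ^ (d + 1) := by
    rw [← mul_neg_geom_sum g (d + 1)]
    have : 1 - g = C c⁻¹ * δ := by rw [hg]; ring
    rw [this, hδ']; ring
  set E := δ • Mt - Mt.submatrix id κ * (A.adjugate * Mt.submatrix ι id) with hE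
  have hErank : E.rank + s ≤ Mt.rank := schur_rank Mt ι κ hδ0
  have hMtrank : Mt.rank ≤ M.rank := rank_map_le' M (tau (F := F) Finset.univ p).toRingHom
  have hEε : E.map ε = 0 := by
    have h1 := schur_rank Mp ι κ hdet
    rw [← hs] at h1
    have h2 := eq_zero_of_rank _ (by omega : ((Mp.submatrix ι κ).det • Mp - Mp.submatrix id κ *
      ((Mp.submatrix ι κ).adjugate * Mp.submatrix ι id)).rank = 0)
    rw [← h2]
    ext1 i j
    simp only [hE, Matrix.map_apply, Matrix.sub_apply, Matrix.smul_apply, smul_eq_mul, map_sub,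
      map_mul, Matrix.mul_apply, map_sum, Matrix.submatrix_apply, id, hεM', hεδ, hεadj]
  set E' := δ' • E with hE'
  have hE'rank : E'.rank ≤ E.rank := rank_smul_le_aux δ' E
  set W := δ' • (A.adjugate * Mt.submatrix ι id) with hW
  have hentry : ∀ i j, Mt i j = E' i j + ∑ l, Mt i (κ l) * W l j + g ^ (d + 1) * Mt i j := by
    intro i j
    have h1 : E' i j = δ' * δ * Mt i j - ∑ l, Mt i (κ l) * W l j :=
      smul_schur_entry δ' δ Mt _ _ i j
    rw [h1, hδδ']
    ring
  refine ⟨E'.map (compS Finset.univ), fun i j => compS_multilinear _ _, ?_, ?_⟩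
  · have h1 := rank_compB Finset.univ E'
    have h2 : E'.map (fil fun μ => ∀ i ∈ Finset.univ, ∑ j, μ (i, j) = 0) = 0 := by
      have h3 : E'.map (fil fun μ => ∀ i ∈ Finset.univ, ∑ j, μ (i, j) = 0) = E'.map ε := by
        ext1 i j
        simp only [Matrix.map_apply, hε, coeff_psi]
        apply fil_congr
        intro μ
        rw [Fintype.sum_prod_type, Finset.sum_eq_zero_iff]
      rw [h3]
      ext1 i j
      have := congrFun (congrFun hEε i) j
      simp only [Matrix.map_apply, Matrix.zero_apply] at this
      simp [hE', this]
    have h4 : E'.map (fil fun μ => ∀ i ∈ Finset.univ, ∑ j, μ (i, j) = 1) =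
        E'.map (compS Finset.univ) := by
      ext1 i j
      simp only [Matrix.map_apply, compS]
      apply fil_congr
      intro μ
      simp
    rw [h2, h4, Matrix.rank_zero, add_zero, Finset.card_univ, Fintype.card_fin] at h1
    exact h1.trans (Nat.mul_le_mul_left _ (by omega))
  · intro r hr
    have := hasPR_add (I := Finset (Fin d) × Fin s) M _ (fun t => t.1)
      (fun t i => compS t.1 (Mt i (κ t.2))) (fun t j => compS t.1ᶜ (W t.2 j))
      (fun t i => compS_multilinear _ _) (fun t j => compS_multilinear _ _) hr (by
        ext1 i j
        have h1 := congrArg (compS Finset.univ) (hentry i j)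
        have hadd : ∀ f g : MvPolynomial (Fin d × Fin n) F, compS Finset.univ (f + g) =
          compS Finset.univ f + compS Finset.univ g := fun f g => fil_add _ f g
        rw [hadd, hadd, compS_univ_pow_mul g _ hεg, add_zero] at h1
        have h2 : compS Finset.univ (Mt i j) = M i j := compS_univ_tau p _ (hM i j)
        rw [h2] at h1
        rw [h1, Matrix.add_apply, Matrix.map_apply, Matrix.sum_apply, Fintype.sum_prod_type,
          Finset.sum_comm]
        congr 1
        refine (fil_sum _ _ _).trans ?_
        refine Finset.sum_congr rfl fun l _ => ?_
        exact compS_univ_mul _ _)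
    simpa using this

theorem exists_point [Fintype F] {a b : ℕ}
    (M : Matrix (Fin a) (Fin b) (MvPolynomial (Fin d × Fin n) F))
    (hM : ∀ i j, IsMultilinear (M i j)) :
    ∃ p : Fin d × Fin n → F, (Fintype.card F - 1) ^ d * M.rank ≤
      Fintype.card F ^ d * (M.map (evT Finset.univ p)).rank := by
  classical
  obtain ⟨p, hp⟩ := multi_block Finset.univ M (by
    intro k i j
    rw [Polynomial.natDegree_le_iff_coeff_eq_zero]
    intro l hl
    rw [coeff_psi]
    ext μ
    rw [coeff_fil, coeff_zero]
    split_ifs with h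
    · by_contra hne
      have h1 := hM i j μ (by rwa [mem_support_iff]) k
      rw [sum_blk, h1] at h
      simp at h
      omega
    · rfl)
  refine ⟨p, ?_⟩
  simpa using hp

theorem main_ind [Fintype F] {a b : ℕ}
    (hq : (0 : ℝ) < (2 ^ d - 1) * ((Fintype.card F : ℝ) - 1) ^ d
        - (2 ^ d - 2) * (Fintype.card F : ℝ) ^ d) (r : ℕ) :
    ∀ M : Matrix (Fin a) (Fin b) (MvPolynomial (Fin d × Fin n) F),
    (∀ i j, IsMultilinear (M i j)) → M.rank = r →
    ∃ t, HasPRDecomp M t ∧ (t : ℝ) ≤ 2 ^ d * ((Fintype.card F : ℝ) - 1) ^ d /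
        ((2 ^ d - 1) * ((Fintype.card F : ℝ) - 1) ^ d
          - (2 ^ d - 2) * (Fintype.card F : ℝ) ^ d) * r := by
  induction r using Nat.strong_induction_on with
  | _ r ih =>
  intro M hM hr
  rcases Nat.eq_zero_or_pos r with h0 | hpos
  · refine ⟨0, ⟨Fin.elim0, Fin.elim0, Fin.elim0, fun t => t.elim0, fun t => t.elim0, ?_⟩, ?_⟩
    · rw [eq_zero_of_rank M (by omega)]; simp
    · simp [h0]
  · obtain ⟨p, hp⟩ := exists_point M hM
    obtain ⟨N, hN, hNr, hdec⟩ := core_step M hM p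
    have hsr : (M.map (evT Finset.univ p)).rank ≤ M.rank :=
      rank_map_le' M (evT (F := F) Finset.univ p).toRingHom
    set s := (M.map (evT Finset.univ p)).rank with hs
    rw [hr] at hp hNr hsr
    have hq1 : 1 ≤ Fintype.card F := Fintype.card_pos
    have hpR : ((Fintype.card F : ℝ) - 1) ^ d * r ≤ (Fintype.card F : ℝ) ^ d * s := by
      have := (Nat.cast_le (α := ℝ)).2 hp
      push_cast [Nat.cast_sub hq1] at this
      exact this
    have hNR : (N.rank : ℝ) ≤ (2 ^ d - 1) * ((r : ℝ) - s) := by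
      have := (Nat.cast_le (α := ℝ)).2 hNr
      push_cast [Nat.cast_sub hsr, Nat.cast_sub (Nat.one_le_two_pow (n := d))] at this
      exact this
    have hsR : (s : ℝ) ≤ r := by exact_mod_cast hsr
    have hP0 : (0 : ℝ) ≤ ((Fintype.card F : ℝ) - 1) ^ d := by
      have : (1 : ℝ) ≤ Fintype.card F := by exact_mod_cast hq1
      exact pow_nonneg (by linarith) _
    have hQ0 : (0 : ℝ) < (Fintype.card F : ℝ) ^ d := by positivity
    have hrR : (0 : ℝ) < r := by exact_mod_cast hpos
    have hm : (2 : ℝ) ^ d = 1 ∧ ((Fintype.card F : ℝ) - 1) ^ d = 1 ∧ (Fintype.card F : ℝ) ^ d = 1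
        ∨ (2 : ℝ) ≤ 2 ^ d := by
      rcases Nat.eq_zero_or_pos d with h | h
      · left; subst h; simp
      · right
        calc (2 : ℝ) = 2 ^ 1 := by norm_num
          _ ≤ 2 ^ d := pow_le_pow_right₀ (by norm_num) h
    have hm1 : (1 : ℝ) ≤ 2 ^ d := one_le_pow₀ (by norm_num)
    have hcast : ∀ t : ℕ, ((2 ^ d * s + t : ℕ) : ℝ) = 2 ^ d * s + t := by
      intro t; push_cast; ring
    have hlt : N.rank < r := by
      have : (N.rank : ℝ) < r := by
        refine lt_of_le_of_lt hNR ?_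
        rcases hm with ⟨h1, -, -⟩ | h2
        · rw [h1]; linarith
        · have e1 := mul_le_mul_of_nonneg_left hpR (by linarith : (0 : ℝ) ≤ 2 ^ d - 1)
          have e2 := mul_pos hq hrR
          refine lt_of_mul_lt_mul_left ?_ hQ0.le
          linarith
      exact_mod_cast this
    obtain ⟨t, ht, htle⟩ := ih N.rank hlt N hN rfl
    refine ⟨_, hdec t ht, ?_⟩
    rw [hcast]
    clear ih hdec hcast hlt ht
    generalize ((Fintype.card F : ℝ) - 1) ^ d = P at *
    generalize ((Fintype.card F : ℝ)) ^ d = Q at *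
    generalize (2 : ℝ) ^ d = m at *
    have hΔ : 0 < (m - 1) * P - (m - 2) * Q := hq
    have hK : 0 ≤ m * P / ((m - 1) * P - (m - 2) * Q) :=
      div_nonneg (mul_nonneg (by linarith) hP0) hq.le
    have h1 : (t : ℝ) ≤ m * P / ((m - 1) * P - (m - 2) * Q) * ((m - 1) * ((r : ℝ) - s)) :=
      htle.trans (mul_le_mul_of_nonneg_left hNR hK)
    have h2 : (m - 2) * (P * r) ≤ (m - 2) * (Q * s) := by
      rcases hm with ⟨e1, e2, e3⟩ | h
      · rw [e1, e2, e3]; linarith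
      · exact mul_le_mul_of_nonneg_left hpR (by linarith)
    have h3 : m * s + m * P / ((m - 1) * P - (m - 2) * Q) * ((m - 1) * ((r : ℝ) - s)) ≤
        m * P / ((m - 1) * P - (m - 2) * Q) * r := by
      rw [div_mul_eq_mul_div, div_mul_eq_mul_div, ← sub_nonneg]
      have e : m * P * r / ((m - 1) * P - (m - 2) * Q) - (m * s + m * P * ((m - 1) * ((r : ℝ) - s)) /
          ((m - 1) * P - (m - 2) * Q)) =
          m * ((m - 2) * (Q * s) - (m - 2) * (P * r)) / ((m - 1) * P - (m - 2) * Q) := by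
        have hne := hΔ.ne'
        rw [eq_div_iff hne, sub_mul, add_mul, div_mul_cancel₀ _ hne, div_mul_cancel₀ _ hne]
        ring
      rw [e]
      exact div_nonneg (mul_nonneg (by linarith) (by linarith)) hq.le
    linarith

end LastPart

end Helpers

/-- Over `F_q` with `(2^d − 1)(q − 1)^d − (2^d − 2)q^d > 0`,
`PR(M) ≤ [2^d (q−1)^d / ((2^d − 1)(q − 1)^d − (2^d − 2)q^d)] · CR(M)`. -/
theorem statement_2 (F : Type*) [Field F] [Fintype F] (d n a b : ℕ) (hn : 1 ≤ n)
    (hq : (0 : ℝ) < (2 ^ d - 1) * ((Fintype.card F : ℝ) - 1) ^ d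
        - (2 ^ d - 2) * (Fintype.card F : ℝ) ^ d)
    (M : Matrix (Fin a) (Fin b) (MvPolynomial (Fin d × Fin n) F))
    (hM : ∀ i j, IsMultilinear (M i j)) :
    (PR M : ℝ) ≤ 2 ^ d * ((Fintype.card F : ℝ) - 1) ^ d /
        ((2 ^ d - 1) * ((Fintype.card F : ℝ) - 1) ^ d
          - (2 ^ d - 2) * (Fintype.card F : ℝ) ^ d) * (CR M : ℝ) := by
  obtain ⟨t, ht, hle⟩ := main_ind hq M.rank M hM rfl
  have h1 : PR M ≤ t := Nat.sInf_le ht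
  have h2 : M.rank ≤ CR M := rank_le_rank_frac M
  have h3 : (PR M : ℝ) ≤ t := by exact_mod_cast h1
  have h4 : (M.rank : ℝ) ≤ CR M := by exact_mod_cast h2
  refine h3.trans (hle.trans (mul_le_mul_of_nonneg_left h4 ?_))
  have hq1 : (1 : ℝ) ≤ Fintype.card F := by exact_mod_cast Fintype.card_pos (α := F)
  exact div_nonneg (mul_nonneg (by positivity) (pow_nonneg (by linarith) _)) hq.le
end
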